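/- arXiv:0909.0918 — 3 statements merged into one kernel-verified Lean document; each statement's English description precedes it below -/
import Mathlib

section
/- For every integer n ≥ 3 there exist prime numbers a₀ < a₁ < … < aₙ (with 2 ≤ a₀) such that ∑_{i=0}^{n-1} 1/aᵢ < 1 < ∑_{i=0}^{n} 1/aᵢ (the sums taken in ℚ or ℝ). -/
namespace KltAux

lemma choose_upper (m : ℕ) : 4 ^ m * (3 * m).choose m ≤ 27 ^ m := by
  have h := add_pow (1 : ℕ) 2 (3 * m)
  have h2 : 1 ^ m * 2 ^ (3 * m - m) * (3 * m).choose m ≤ (1 + 2) ^ (3 * m) := by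
    rw [h]
    exact Finset.single_le_sum
      (f := fun k => 1 ^ k * 2 ^ (3 * m - k) * (3 * m).choose k)
      (fun _ _ => Nat.zero_le _) (Finset.mem_range.2 (by omega))
  have e : 3 * m - m = 2 * m := by omega
  rw [e, pow_mul, pow_mul] at h2
  norm_num at h2
  exact h2

lemma choose_step (k : ℕ) : (3 * (k + 1)).choose (k + 1) * (2 * (k + 1) * (2 * k + 1))
    = (3 * k).choose k * (3 * (3 * k + 2) * (3 * k + 1)) := by
  have h1 := Nat.add_choose_mul_factorial_mul_factorial (2 * k) k
  have h2 := Nat.add_choose_mul_factorial_mul_factorial (2 * (k + 1)) (k + 1)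
  have e1 : 2 * k + k = 3 * k := by ring
  have e2 : 2 * (k + 1) + (k + 1) = 3 * k + 1 + 1 + 1 := by ring
  have e3 : 2 * (k + 1) = 2 * k + 1 + 1 := by ring
  have e4 : 3 * (k + 1) = 3 * k + 1 + 1 + 1 := by ring
  rw [e1] at h1
  rw [e2, e3] at h2
  simp only [Nat.factorial_succ] at h2
  rw [e4]
  have hp : 0 < (k + 1) * ((2 * k).factorial * k.factorial) := by positivity
  apply Nat.eq_of_mul_eq_mul_right hp
  rw [← h1] at h2
  linear_combination h2

lemma choose_lower (k : ℕ) : 27 ^ k ≤ (2 * k + 1) * 4 ^ k * (3 * k).choose k := by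
  induction k with
  | zero => simp
  | succ k ih =>
    have hs := choose_step k
    have hp : 0 < 2 * (k + 1) * (2 * k + 1) := by positivity
    apply Nat.le_of_mul_le_mul_right _ hp
    calc 27 ^ (k + 1) * (2 * (k + 1) * (2 * k + 1))
        = 27 ^ k * (27 * (2 * (k + 1) * (2 * k + 1))) := by ring
      _ ≤ ((2 * k + 1) * 4 ^ k * (3 * k).choose k) * (27 * (2 * (k + 1) * (2 * k + 1))) :=
          Nat.mul_le_mul_right _ ih
      _ = (4 ^ k * (3 * k).choose k) * ((2 * k + 1) * (27 * (2 * (k + 1) * (2 * k + 1)))) := by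
          ring
      _ ≤ (4 ^ k * (3 * k).choose k) * ((2 * (k + 1) + 1) * 4 * (3 * (3 * k + 2) * (3 * k + 1))) := by
          apply Nat.mul_le_mul_left
          nlinarith [Nat.zero_le k, Nat.zero_le (k ^ 2), Nat.zero_le (k ^ 3)]
      _ = (2 * (k + 1) + 1) * 4 ^ (k + 1) * ((3 * k).choose k * (3 * (3 * k + 2) * (3 * k + 1))) := by
          ring
      _ = (2 * (k + 1) + 1) * 4 ^ (k + 1) * (3 * (k + 1)).choose (k + 1)
            * (2 * (k + 1) * (2 * k + 1)) := by rw [← hs]; ring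

lemma fact_eq {p n k : ℕ} (hp : p.Prime) (hkn : k ≤ n) (h : n < p ^ 2) :
    (n.choose k).factorization p = if p ≤ k % p + (n - k) % p then 1 else 0 := by
  rw [Nat.factorization_choose hp hkn (Nat.log_lt_of_lt_pow' (by norm_num) h : Nat.log p n < 2)]
  have : Finset.Ico 1 2 = {1} := rfl
  rw [this, Finset.filter_singleton]
  split_ifs with h1 h2 h2 <;> simp_all

lemma key_dvd (m : ℕ) (hm : 0 < m) (no : ∀ p : ℕ, p.Prime → 4 * m < p → 6 * m < p) :
    (6 * m).choose (2 * m) ∣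
      (∏ p ∈ (Finset.Icc 1 (Nat.sqrt (6 * m))), p ^ Nat.log p (6 * m)) *
        (primorial m * (3 * m).choose m) := by
  have hK : (∏ p ∈ (Finset.Icc 1 (Nat.sqrt (6 * m))), p ^ Nat.log p (6 * m)) ≠ 0 := by
    rw [Finset.prod_ne_zero_iff]
    intro p hp
    have := (Finset.mem_Icc.1 hp).1
    positivity
  have hP := primorial_ne_zero m
  have hC : (3 * m).choose m ≠ 0 := Nat.choose_ne_zero (by omega)
  have hB : (6 * m).choose (2 * m) ≠ 0 := Nat.choose_ne_zero (by omega)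
  rw [← Nat.factorization_prime_le_iff_dvd hB (mul_ne_zero hK (mul_ne_zero hP hC))]
  intro p hp
  rw [Nat.factorization_mul hK (mul_ne_zero hP hC), Nat.factorization_mul hP hC]
  simp only [Finsupp.add_apply]
  by_cases hs : p ≤ Nat.sqrt (6 * m)
  · have h1 : p ^ Nat.log p (6 * m) ∣
        ∏ p ∈ (Finset.Icc 1 (Nat.sqrt (6 * m))), p ^ Nat.log p (6 * m) :=
      Finset.dvd_prod_of_mem (fun p => p ^ Nat.log p (6 * m)) (Finset.mem_Icc.2 ⟨hp.one_le, hs⟩)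
    have h2 := (hp.pow_dvd_iff_le_factorization hK).1 h1
    have h3 : ((6 * m).choose (2 * m)).factorization p ≤ Nat.log p (6 * m) :=
      Nat.factorization_choose_le_log
    omega
  · have hs2 : 6 * m < p ^ 2 := Nat.sqrt_lt'.1 (not_le.1 hs)
    by_cases hpm : p ≤ m
    · have h1 : ((6 * m).choose (2 * m)).factorization p ≤ 1 := Nat.factorization_choose_le_one hs2
      have h2 := hp.factorization_pos_of_dvd hP (hp.dvd_primorial_iff.2 hpm)
      omega
    · by_cases h4 : 4 * m < p
      · rw [Nat.factorization_choose_eq_zero_of_lt (no p hp h4)]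
        omega
      · have hle : ((6 * m).choose (2 * m)).factorization p ≤ ((3 * m).choose m).factorization p := by
          rw [fact_eq hp (by omega) hs2, fact_eq hp (by omega) (by omega)]
          have e1 : 6 * m - 2 * m = 4 * m := by omega
          have e2 : 3 * m - m = 2 * m := by omega
          rw [e1, e2]
          have a1 : m % p = m := Nat.mod_eq_of_lt (by omega)
          rw [a1]
          by_cases c3 : 3 * m < p
          · have a2 : 2 * m % p = 2 * m := Nat.mod_eq_of_lt (by omega)
            have a4 : 4 * m % p = 4 * m - p := by
              rw [Nat.mod_eq_sub_mod (by omega), Nat.mod_eq_of_lt (by omega)]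
            rw [a2, a4, if_neg (by omega)]
            omega
          · by_cases c2 : 2 * m < p
            · have a2 : 2 * m % p = 2 * m := Nat.mod_eq_of_lt (by omega)
              rw [a2, if_pos (show p ≤ m + 2 * m by omega)]
              split_ifs <;> omega
            · have a2 : 2 * m % p = 2 * m - p := by
                rw [Nat.mod_eq_sub_mod (by omega), Nat.mod_eq_of_lt (by omega)]
              rw [a2]
              by_cases c1 : 2 * p ≤ 3 * m
              · rw [if_pos (show p ≤ m + (2 * m - p) by omega)]
                split_ifs <;> omega
              · have a4 : 4 * m % p = 4 * m - p - p := by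
                  rw [Nat.mod_eq_sub_mod (by omega), Nat.mod_eq_sub_mod (by omega),
                    Nat.mod_eq_of_lt (by omega)]
                rw [a4, if_neg (by omega)]
                omega
        omega

lemma pow16 (t : ℕ) (ht : 128 ≤ t) : t ^ 16 ≤ 2 ^ (t - 2) := by
  induction t, ht using Nat.le_induction with
  | base => norm_num
  | succ t ht ih =>
    have h1 : (128 * (t + 1)) ^ 16 ≤ (129 * t) ^ 16 := Nat.pow_le_pow_left (by omega) _
    rw [mul_pow, mul_pow] at h1
    have h2 : (129 : ℕ) ^ 16 ≤ 128 ^ 16 * 2 := by norm_num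
    have h3 : (t + 1) ^ 16 ≤ 2 * t ^ 16 := by
      apply Nat.le_of_mul_le_mul_left _ (show 0 < 128 ^ 16 by norm_num)
      calc 128 ^ 16 * (t + 1) ^ 16 ≤ 129 ^ 16 * t ^ 16 := h1
        _ ≤ 128 ^ 16 * 2 * t ^ 16 := Nat.mul_le_mul_right _ h2
        _ = _ := by ring
    have e : t + 1 - 2 = (t - 2) + 1 := by omega
    rw [e, pow_succ 2]
    linarith

lemma big (m : ℕ) (hm : 2700 ≤ m) : ∃ p : ℕ, p.Prime ∧ 4 * m < p ∧ p ≤ 6 * m := by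
  by_contra! no
  have hd := Nat.le_of_dvd (by
    have hK : 0 < (∏ p ∈ (Finset.Icc 1 (Nat.sqrt (6 * m))), p ^ Nat.log p (6 * m)) := by
      apply Finset.prod_pos
      intro p hp
      have := (Finset.mem_Icc.1 hp).1
      positivity
    have := primorial_pos m
    have := Nat.choose_pos (show m ≤ 3 * m by omega)
    positivity) (key_dvd m (by omega) no)
  have hK : (∏ p ∈ (Finset.Icc 1 (Nat.sqrt (6 * m))), p ^ Nat.log p (6 * m))
      ≤ (6 * m) ^ Nat.sqrt (6 * m) := by
    calc _ ≤ ∏ p ∈ (Finset.Icc 1 (Nat.sqrt (6 * m))), (6 * m) :=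
          Finset.prod_le_prod' fun p _ => Nat.pow_log_le_self p (by omega)
      _ = _ := by simp
  have hu := choose_upper m
  have hl := choose_lower (2 * m)
  have hpr := primorial_le_four_pow m
  have e6 : 3 * (2 * m) = 6 * m := by ring
  rw [e6] at hl
  obtain ⟨t, ht⟩ : ∃ t, t = Nat.sqrt (6 * m) + 1 := ⟨_, rfl⟩
  have hs : Nat.sqrt (6 * m) = t - 1 := by omega
  have hs1 : 127 ≤ Nat.sqrt (6 * m) := Nat.le_sqrt.2 (by omega)
  have hlt : 6 * m < t ^ 2 := by
    rw [ht, pow_two]; exact Nat.lt_succ_sqrt _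
  have hge : (t - 1) * (t - 1) ≤ 6 * m := by rw [← hs]; exact Nat.sqrt_le _
  rw [hs] at hK hd
  generalize (∏ p ∈ (Finset.Icc 1 (t - 1)), p ^ Nat.log p (6 * m)) = K at hK hd
  have hL : (2 * (2 * m) + 1) * K ≤ t ^ (2 * t) := by
    calc (2 * (2 * m) + 1) * K ≤ t ^ 2 * (t ^ 2) ^ (t - 1) := by
          apply Nat.mul_le_mul (by omega)
          exact hK.trans (Nat.pow_le_pow_left hlt.le _)
      _ = t ^ (2 * t) := by
          rw [← pow_mul, ← pow_add]; congr 1; omega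
  have h27 : 27 ^ m ≤ 16 ^ m * t ^ (2 * t) := by
    apply Nat.le_of_mul_le_mul_right _ (show 0 < 27 ^ m by positivity)
    calc 27 ^ m * 27 ^ m = 27 ^ (2 * m) := by rw [← pow_add]; congr 1; omega
      _ ≤ _ := hl
      _ ≤ (2 * (2 * m) + 1) * 4 ^ (2 * m) * (K * (4 ^ m * (3 * m).choose m)) := by
          apply Nat.mul_le_mul_left
          exact hd.trans (Nat.mul_le_mul_left _ (Nat.mul_le_mul_right _ hpr))
      _ ≤ (2 * (2 * m) + 1) * 4 ^ (2 * m) * (K * 27 ^ m) := by gcongr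
      _ = 16 ^ m * ((2 * (2 * m) + 1) * K) * 27 ^ m := by
          rw [pow_mul]; norm_num; ring
      _ ≤ _ := by gcongr
  have h8 : 8 ^ m ≤ (t ^ (2 * t)) ^ 4 := by
    apply Nat.le_of_mul_le_mul_left _ (show 0 < (16 ^ m) ^ 4 by positivity)
    calc (16 ^ m) ^ 4 * 8 ^ m = (16 ^ 4 * 8) ^ m := by
          rw [mul_pow, ← pow_mul, ← pow_mul, mul_comm m 4]
      _ ≤ (27 ^ 4) ^ m := Nat.pow_le_pow_left (by norm_num) _
      _ = (27 ^ m) ^ 4 := by rw [← pow_mul, ← pow_mul, mul_comm m 4]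
      _ ≤ (16 ^ m * t ^ (2 * t)) ^ 4 := Nat.pow_le_pow_left h27 _
      _ = _ := by rw [mul_pow]
  have h2 : 2 ^ (6 * m) ≤ 2 ^ ((t - 2) * t) := by
    calc 2 ^ (6 * m) = (8 ^ m) ^ 2 := by
          rw [show (8 : ℕ) = 2 ^ 3 by norm_num, ← pow_mul, ← pow_mul]; congr 1; omega
      _ ≤ ((t ^ (2 * t)) ^ 4) ^ 2 := Nat.pow_le_pow_left h8 _
      _ = (t ^ 16) ^ t := by
          rw [← pow_mul, ← pow_mul, ← pow_mul]; congr 1; ring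
      _ ≤ (2 ^ (t - 2)) ^ t := Nat.pow_le_pow_left (pow16 t (by omega)) _
      _ = _ := by rw [← pow_mul]
  have h3 := (Nat.pow_le_pow_iff_right (by norm_num)).1 h2
  obtain ⟨u, rfl⟩ : ∃ u, t = u + 2 := ⟨t - 2, by omega⟩
  simp only [Nat.add_sub_cancel] at h3
  have e : u + 2 - 1 = u + 1 := by omega
  rw [e] at hge
  nlinarith

lemma prime_gap (N : ℕ) (hN : 41 ≤ N) : ∃ p : ℕ, p.Prime ∧ N < p ∧ 5 * p ≤ 8 * N := by
  by_cases h61 : N < 61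
  · exact ⟨61, by norm_num, h61, by omega⟩
  by_cases h97 : N < 97
  · exact ⟨97, by norm_num, h97, by omega⟩
  by_cases h151 : N < 151
  · exact ⟨151, by norm_num, h151, by omega⟩
  by_cases h241 : N < 241
  · exact ⟨241, by norm_num, h241, by omega⟩
  by_cases h383 : N < 383
  · exact ⟨383, by norm_num, h383, by omega⟩
  by_cases h607 : N < 607
  · exact ⟨607, by norm_num, h607, by omega⟩
  by_cases h971 : N < 971
  · exact ⟨971, by norm_num, h971, by omega⟩
  by_cases h1553 : N < 1553
  · exact ⟨1553, by norm_num, h1553, by omega⟩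
  by_cases h2477 : N < 2477
  · exact ⟨2477, by norm_num, h2477, by omega⟩
  by_cases h3947 : N < 3947
  · exact ⟨3947, by norm_num, h3947, by omega⟩
  by_cases h6311 : N < 6311
  · exact ⟨6311, by norm_num, h6311, by omega⟩
  by_cases h10093 : N < 10093
  · exact ⟨10093, by norm_num, h10093, by omega⟩
  by_cases h16141 : N < 16141
  · exact ⟨16141, by norm_num, h16141, by omega⟩
  obtain ⟨p, hp, h1, h2⟩ := big ((N + 3) / 4) (by omega)
  exact ⟨p, hp, by omega, by omega⟩

lemma main (n : ℕ) (hn : 3 ≤ n) :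
    ∃ a : ℕ → ℕ,
      (∀ i, i ≤ n → Nat.Prime (a i)) ∧
      (∀ i j, i < j → j ≤ n → a i < a j) ∧
      41 ≤ a n ∧
      (∑ i ∈ Finset.range n, (1 : ℚ) / (a i : ℚ)) < 1 ∧
      1 < ∑ i ∈ Finset.range (n + 1), (1 : ℚ) / (a i : ℚ) := by
  induction n, hn using Nat.le_induction with
  | base =>
    refine ⟨fun i => if i = 0 then 2 else if i = 1 then 3 else if i = 2 then 7 else 41,
      ?_, ?_, ?_, ?_, ?_⟩
    · intro i hi
      interval_cases i <;> norm_num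
    · intro i j hij hj
      interval_cases j <;> interval_cases i <;> norm_num
    · norm_num
    · norm_num [Finset.sum_range_succ]
    · norm_num [Finset.sum_range_succ]
  | succ n hn ih =>
    obtain ⟨a, hp, hlt, h41, hS, hS1⟩ := ih
    rw [Finset.sum_range_succ] at hS1
    set S := ∑ i ∈ Finset.range n, (1 : ℚ) / (a i : ℚ) with hSd
    have hr : 0 < 1 - S := by linarith
    have hapos : (0 : ℚ) < a n := by exact_mod_cast (by omega : 0 < a n)
    obtain ⟨x, hx⟩ : ∃ x : ℚ, x = 1 / (1 - S) := ⟨_, rfl⟩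
    have hxp : 0 < x := by rw [hx]; positivity
    have hrx : 1 - S = 1 / x := by rw [hx]; simp
    have hax : (a n : ℚ) < x := by
      have : 1 / x < 1 / (a n : ℚ) := by linarith
      exact (one_div_lt_one_div hxp hapos).1 this
    have hfl : a n ≤ ⌊x⌋₊ := Nat.le_floor hax.le
    obtain ⟨b, hb, hb1, hb2⟩ := prime_gap ⌊x⌋₊ (by omega)
    obtain ⟨c, hc, hc1, hc2⟩ := prime_gap b (by omega)
    have hxb : x < b := Nat.lt_of_floor_lt hb1
    have hbx : 5 * (b : ℚ) ≤ 8 * x := by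
      have h1 : (⌊x⌋₊ : ℚ) ≤ x := Nat.floor_le hxp.le
      have h2 : 5 * (b : ℚ) ≤ 8 * (⌊x⌋₊ : ℚ) := by exact_mod_cast hb2
      linarith
    have hcb : 5 * (c : ℚ) ≤ 8 * b := by exact_mod_cast hc2
    have hbp : (0 : ℚ) < b := hxp.trans hxb
    have hcp : (0 : ℚ) < c := by exact_mod_cast hc.pos
    have hsum : ∑ i ∈ Finset.range n,
        (1 : ℚ) / ((if i < n then a i else if i = n then b else c : ℕ) : ℚ) = S := by
      apply Finset.sum_congr rfl
      intro i hi
      rw [if_pos (Finset.mem_range.1 hi)]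
    have hB : 1 / (b : ℚ) < 1 / x := one_div_lt_one_div_of_lt hxp hxb
    have hB2 : 5 / 8 * (1 / x) ≤ 1 / (b : ℚ) := by
      rw [mul_one_div, div_le_div_iff₀ hxp hbp]; linarith
    have hC2 : 5 / 8 * (1 / (b : ℚ)) ≤ 1 / (c : ℚ) := by
      rw [mul_one_div, div_le_div_iff₀ hbp hcp]; linarith
    have hx1 : 0 < 1 / x := by positivity
    refine ⟨fun i => if i < n then a i else if i = n then b else c, ?_, ?_, ?_, ?_, ?_⟩
    · intro i hi
      dsimp only
      split_ifs with h1 h2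
      · exact hp i h1.le
      · exact hb
      · exact hc
    · intro i j hij hj
      dsimp only
      have key : ∀ i, i < n → a i < b := fun i hi => by
        have := hlt i n hi le_rfl
        omega
      split_ifs with h1 h2 h3 h4 h5 h6
      · exact hlt i j hij h2.le
      · exact key i h1
      · exact (key i h1).trans hc1
      all_goals omega
    · dsimp only
      rw [if_neg (by omega), if_neg (by omega)]
      omega
    · rw [Finset.sum_range_succ, hsum]
      simp only [lt_irrefl, if_false, if_true]
      linarith
    · rw [Finset.sum_range_succ, Finset.sum_range_succ, hsum]
      dsimp only
      rw [if_neg (lt_irrefl n), if_pos rfl, if_neg (by omega : ¬ n + 1 < n),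
        if_neg (by omega : ¬ n + 1 = n)]
      linarith

end KltAux


/-- For every integer `n ≥ 3` there exist primes `a₀ < a₁ < … < aₙ` (with `2 ≤ a₀`)
such that `∑_{i=0}^{n-1} 1/aᵢ < 1 < ∑_{i=0}^{n} 1/aᵢ`. -/
theorem stmt_0 (n : ℕ) (hn : 3 ≤ n) :
    ∃ a : ℕ → ℕ,
      (∀ i, i ≤ n → Nat.Prime (a i)) ∧
      (∀ i j, i < j → j ≤ n → a i < a j) ∧
      2 ≤ a 0 ∧
      (∑ i ∈ Finset.range n, (1 : ℚ) / (a i : ℚ)) < 1 ∧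
      1 < ∑ i ∈ Finset.range (n + 1), (1 : ℚ) / (a i : ℚ) := by
  obtain ⟨a, h1, h2, _, h4, h5⟩ := KltAux.main n hn
  exact ⟨a, h1, h2, (h1 0 (Nat.zero_le _)).two_le, h4, h5⟩
end

section
/- Let G be a finite subgroup of SL(4,ℂ) such that the scalar matrix −I belongs to G, the quotient G/{±I} is isomorphic to the alternating group A₆, and the tautological action of G on ℂ⁴ is irreducible. Then G has no semi-invariants of degree at most 4: there is no nonzero homogeneous polynomial f ∈ ℂ[x₁,x₂,x₃,x₄] with 1 ≤ deg f ≤ 4 and a group homomorphism χ : G → ℂˣ such that g·f = χ(g)·f for all g ∈ G. -/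
/-- The element `-I` of `SL(4, ℂ)`. -/
noncomputable def negId : Matrix.SpecialLinearGroup (Fin 4) ℂ :=
  ⟨-1, by simp [Matrix.det_neg]; norm_num⟩

/-- The action of a matrix `g` on polynomials, `f ↦ f(g ⬝ x)`; the group action of `g`
on a polynomial `f` is then `polyAct g⁻¹ f`, i.e. `(g · f)(x) = f(g⁻¹ ⬝ x)`. -/
noncomputable def polyAct (g : Matrix (Fin 4) (Fin 4) ℂ) :
    MvPolynomial (Fin 4) ℂ → MvPolynomial (Fin 4) ℂ :=
  MvPolynomial.aeval fun i => ∑ j, MvPolynomial.C (g i j) * MvPolynomial.X j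

set_option maxRecDepth 100000 in
lemma grp_aux {G : Type*} [Group G] (z : G) (hz : ∀ g, g * z = z * g) (hz2 : z * z = 1)
    (φ : G →* alternatingGroup (Fin 6)) (hs : Function.Surjective φ)
    (hk : φ.ker = Subgroup.zpowers z) :
    ∃ a b t X Y : G, a ^ 3 = 1 ∧ b ^ 3 = 1 ∧ a * b = b * a ∧ t * a = b * t ∧ t * b = a⁻¹ * t ∧
      a ≠ 1 ∧ t = X ^ 2 * Y ^ 2 * (X ^ 2)⁻¹ * (Y ^ 2)⁻¹ := by
  have hker : ∀ g, φ g = 1 → g = 1 ∨ g = z := by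
    intro g hg
    have : g ∈ φ.ker := hg
    rw [hk, Subgroup.mem_zpowers_iff] at this
    obtain ⟨k, rfl⟩ := this
    have h2 : z ^ (2 : ℤ) = 1 := by rw [zpow_two, hz2]
    rcases Int.even_or_odd' k with ⟨m, rfl | rfl⟩
    · left; rw [zpow_mul, h2, one_zpow]
    · right; rw [zpow_add, zpow_mul, h2, one_zpow]; simp
  have hz3 : z ^ 3 = z := by rw [pow_succ, pow_two, hz2, one_mul]
  have huniq : ∀ u w : G, u ^ 3 = 1 → w ^ 3 = 1 → φ u = φ w → u = w := by
    intro u w hu hw h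
    have h1 : φ (u * w⁻¹) = 1 := by rw [map_mul, map_inv, h, mul_inv_cancel]
    rcases hker _ h1 with h2 | h2
    · exact mul_inv_eq_one.mp h2
    · have h3 : u = z * w := by rw [← h2]; group
      have h4 : (z * w) ^ 3 = z ^ 3 * w ^ 3 := (show Commute z w from (hz w).symm).mul_pow 3
      rw [← h3, hu, hw, hz3, mul_one] at h4
      rw [h3, ← h4, one_mul]
  have hlift : ∀ c : alternatingGroup (Fin 6), c ^ 3 = 1 → ∃ u, u ^ 3 = 1 ∧ φ u = c := by
    intro c hc
    obtain ⟨u, rfl⟩ := hs c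
    refine ⟨u ^ 4, ?_, ?_⟩
    · rw [← map_pow] at hc
      have h6 : (u ^ 3) ^ 2 = 1 := by
        rcases hker _ hc with h | h <;> rw [h]
        · simp
        · rw [pow_two, hz2]
      calc (u ^ 4) ^ 3 = ((u ^ 3) ^ 2) ^ 2 := by simp only [← pow_mul]
        _ = 1 := by rw [h6, one_pow]
    · rw [map_pow, pow_succ, hc, one_mul]
  let A : alternatingGroup (Fin 6) := ⟨c[0, 1, 2], by rw [Equiv.Perm.mem_alternatingGroup]; decide⟩
  let B : alternatingGroup (Fin 6) := ⟨c[3, 4, 5], by rw [Equiv.Perm.mem_alternatingGroup]; decide⟩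
  let x : alternatingGroup (Fin 6) := ⟨c[1, 3, 4, 2, 5], by rw [Equiv.Perm.mem_alternatingGroup]; decide⟩
  let y : alternatingGroup (Fin 6) := ⟨c[0, 2, 1, 3, 4], by rw [Equiv.Perm.mem_alternatingGroup]; decide⟩
  have hA3 : A ^ 3 = 1 := by apply Subtype.ext; decide
  have hB3 : B ^ 3 = 1 := by apply Subtype.ext; decide
  obtain ⟨a, ha, hφa⟩ := hlift A hA3
  obtain ⟨b, hb, hφb⟩ := hlift B hB3
  obtain ⟨X, hX⟩ := hs x
  obtain ⟨Y, hY⟩ := hs y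
  refine ⟨a, b, _, X, Y, ha, hb, ?_, ?_, ?_, ?_, rfl⟩
  · have := huniq (b⁻¹ * a * b) a (by
      have := conj_pow (i := 3) (a := b⁻¹) (b := a)
      rw [inv_inv] at this; rw [this, ha]; group) ha (by
      simp only [map_mul, map_inv, hφa, hφb]; apply Subtype.ext; decide)
    calc a * b = b * (b⁻¹ * a * b) := by group
      _ = _ := by rw [this]
  · have := huniq ((X ^ 2 * Y ^ 2 * (X ^ 2)⁻¹ * (Y ^ 2)⁻¹) * a *
      (X ^ 2 * Y ^ 2 * (X ^ 2)⁻¹ * (Y ^ 2)⁻¹)⁻¹) b (by rw [conj_pow, ha]; group) hb (by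
      simp only [map_mul, map_inv, map_pow, hφa, hφb, hX, hY]; apply Subtype.ext; decide)
    exact mul_inv_eq_iff_eq_mul.mp this
  · have := huniq ((X ^ 2 * Y ^ 2 * (X ^ 2)⁻¹ * (Y ^ 2)⁻¹) * b *
      (X ^ 2 * Y ^ 2 * (X ^ 2)⁻¹ * (Y ^ 2)⁻¹)⁻¹) a⁻¹ (by rw [conj_pow, hb]; group)
      (by rw [inv_pow, ha, inv_one]) (by
      simp only [map_mul, map_inv, map_pow, hφa, hφb, hX, hY]; apply Subtype.ext; decide)
    exact mul_inv_eq_iff_eq_mul.mp this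
  · rintro rfl
    rw [map_one] at hφa
    exact absurd (congrArg Subtype.val hφa) (by decide)

open MvPolynomial in
lemma polyAct_mul (g h : Matrix (Fin 4) (Fin 4) ℂ) (f : MvPolynomial (Fin 4) ℂ) :
    polyAct (g * h) f = polyAct h (polyAct g f) := by
  unfold polyAct
  rw [← AlgHom.comp_apply]
  refine DFunLike.congr_fun (?_ : (aeval _ : MvPolynomial (Fin 4) ℂ →ₐ[ℂ] _) = _) f
  apply MvPolynomial.algHom_ext
  intro i
  simp only [AlgHom.comp_apply, aeval_X, map_sum, map_mul, Matrix.mul_apply, Finset.sum_mul,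
    Finset.mul_sum]
  rw [Finset.sum_comm]
  refine Finset.sum_congr rfl fun j _ => Finset.sum_congr rfl fun k _ => ?_
  simp [algHom_C, algebraMap_eq, mul_assoc]

open MvPolynomial in
lemma polyAct_diag_monomial (c : Fin 4 → ℂ) (m : Fin 4 →₀ ℕ) (r : ℂ) :
    polyAct (Matrix.diagonal c) (monomial m r) = monomial m ((∏ i, c i ^ m i) * r) := by
  unfold polyAct
  have : (fun i => ∑ j, C (Matrix.diagonal c i j) * X j) =
      fun i => (C (c i) * X i : MvPolynomial (Fin 4) ℂ) := by
    funext i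
    rw [Finset.sum_eq_single i]
    · simp
    · intro j _ hj; simp [Matrix.diagonal_apply_ne _ hj.symm]
    · simp
  rw [this, aeval_monomial, monomial_eq (s := m), Finsupp.prod_fintype _ _ (by simp),
    Finsupp.prod_fintype _ _ (by simp)]
  simp only [mul_pow, Finset.prod_mul_distrib, algebraMap_eq, map_mul, map_prod, map_pow]
  ring

open MvPolynomial in
lemma polyAct_diag_coeff (c : Fin 4 → ℂ) (m : Fin 4 →₀ ℕ) (f : MvPolynomial (Fin 4) ℂ) :
    coeff m (polyAct (Matrix.diagonal c) f) = (∏ i, c i ^ m i) * coeff m f := by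
  induction f using MvPolynomial.induction_on' with
  | monomial u r =>
    rw [polyAct_diag_monomial, coeff_monomial, coeff_monomial]
    split_ifs with h
    · rw [h]
    · simp
  | add p q hp hq =>
    have : polyAct (Matrix.diagonal c) (p + q) = polyAct (Matrix.diagonal c) p +
      polyAct (Matrix.diagonal c) q := by unfold polyAct; simp
    rw [this, coeff_add, hp, hq, coeff_add, mul_add]

lemma polyAct_one (f : MvPolynomial (Fin 4) ℂ) : polyAct 1 f = f := by
  ext m
  rw [← Matrix.diagonal_one, polyAct_diag_coeff]
  simp

lemma polyAct_smul (g : Matrix (Fin 4) (Fin 4) ℂ) (c : ℂ) (f : MvPolynomial (Fin 4) ℂ) :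
    polyAct g (c • f) = c • polyAct g f := by
  unfold polyAct; simp

lemma polyAct_mul_poly (g : Matrix (Fin 4) (Fin 4) ℂ) (p q : MvPolynomial (Fin 4) ℂ) :
    polyAct g (p * q) = polyAct g p * polyAct g q := by
  unfold polyAct; simp

lemma polyAct_zero (g : Matrix (Fin 4) (Fin 4) ℂ) : polyAct g 0 = 0 := by
  unfold polyAct; simp

lemma polyAct_hom (g : Matrix (Fin 4) (Fin 4) ℂ) {f : MvPolynomial (Fin 4) ℂ} {d : ℕ}
    (hf : f.IsHomogeneous d) : (polyAct g f).IsHomogeneous d := by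
  unfold polyAct
  have := hf.aeval (n := 1) (fun i => ∑ j, MvPolynomial.C (g i j) * MvPolynomial.X j) (by
    intro i
    refine MvPolynomial.IsHomogeneous.sum _ _ _ fun j _ => ?_
    simpa using (MvPolynomial.isHomogeneous_C (Fin 4) (g i j)).mul
      (MvPolynomial.isHomogeneous_X ℂ j))
  simpa using this

lemma cube_eig (M : Matrix (Fin 4) (Fin 4) ℂ) (hM : M ^ 3 = 1) (u : Fin 4 → ℂ) (hu : u ≠ 0) :
    ∃ (k : ℂ) (N : Matrix (Fin 4) (Fin 4) ℂ), k ^ 3 = 1 ∧ N = 1 + k ^ 2 • M + k • M ^ 2 ∧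
      N.mulVec u ≠ 0 ∧ M * N = k • N := by
  obtain ⟨w, hw⟩ : ∃ w : ℂ, w ^ 2 + w + 1 = 0 := by
    obtain ⟨w, hw⟩ := IsAlgClosed.exists_root (Polynomial.X ^ 2 + Polynomial.X + 1 : Polynomial ℂ)
      (by
        have : (Polynomial.X ^ 2 + Polynomial.X + 1 : Polynomial ℂ).degree = 2 := by
          compute_degree!
        rw [this]; decide)
    exact ⟨w, by simpa using hw⟩
  have hw3 : w ^ 3 = 1 := by linear_combination (w - 1) * hw
  have key : ∀ k : ℂ, k ^ 3 = 1 → M * (1 + k ^ 2 • M + k • M ^ 2) =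
      k • (1 + k ^ 2 • M + k • M ^ 2) := by
    intro k hk
    have h1 : M * M ^ 2 = 1 := by rw [← hM, pow_succ' M 2]
    have h2 : k * k ^ 2 = 1 := by rw [← hk]; ring
    simp only [mul_add, mul_one, Matrix.mul_smul, h1, smul_add, smul_smul, h2, one_smul, ← pow_two]
    abel
  by_contra hcon
  push Not at hcon
  have hall : ∀ k : ℂ, k ^ 3 = 1 → (1 + k ^ 2 • M + k • M ^ 2).mulVec u = 0 := by
    intro k hk
    by_contra h
    exact hcon k _ hk rfl h (key k hk)
  have e1 := hall 1 (by norm_num)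
  have e2 := hall w hw3
  have e3 := hall (w ^ 2) (by rw [← pow_mul, mul_comm, pow_mul, hw3, one_pow])
  apply hu
  simp only [Matrix.add_mulVec, Matrix.smul_mulVec, Matrix.one_mulVec] at e1 e2 e3
  funext i
  have f1 := congrFun e1 i
  have f2 := congrFun e2 i
  have f3 := congrFun e3 i
  simp only [Pi.add_apply, Pi.smul_apply, smul_eq_mul, Pi.zero_apply] at f1 f2 f3 ⊢
  generalize u i = p at *
  generalize M.mulVec u i = q at *
  generalize (M ^ 2).mulVec u i = r at *
  linear_combination (f1 + f2 + f3) / 3 - q / 3 * (w ^ 2 - w + 1) * hw - r / 3 * hw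

lemma find_eig {G : Type*} [Group G] (ρ : G →* Matrix (Fin 4) (Fin 4) ℂ) (a b t : G)
    (ha : a ^ 3 = 1) (hb : b ^ 3 = 1) (hab : a * b = b * a) (hta : t * a = b * t)
    (htb : t * b = a⁻¹ * t) (hne : ρ a ≠ 1) :
    ∃ (a b : G) (ζ : ℂ) (v : Fin 4 → ℂ), a ^ 3 = 1 ∧ b ^ 3 = 1 ∧ t * a = b * t ∧ t * b = a⁻¹ * t ∧
      ζ ^ 2 + ζ + 1 = 0 ∧ v ≠ 0 ∧ (ρ a).mulVec v = ζ • v ∧ (ρ b).mulVec v = v := by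
  have hA : ρ a ^ 3 = 1 := by rw [← map_pow, ha, map_one]
  have hB : ρ b ^ 3 = 1 := by rw [← map_pow, hb, map_one]
  have hAB : ρ a * ρ b = ρ b * ρ a := by rw [← map_mul, hab, map_mul]
  obtain ⟨u, hu⟩ : ∃ u, (ρ a - 1).mulVec u ≠ 0 := by
    by_contra h
    push Not at h
    apply hne
    rw [← sub_eq_zero]
    apply Matrix.mulVec_injective
    funext u
    simpa using h u
  obtain ⟨ζ, N, hζ, hN, hNu, hMN⟩ := cube_eig _ hA _ hu
  have hζ1 : ζ ≠ 1 := by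
    rintro rfl
    apply hNu
    rw [Matrix.mulVec_mulVec]
    have : N * (ρ a - 1) = ρ a ^ 3 - 1 := by
      rw [hN]; simp only [one_pow, one_smul]; noncomm_ring
    rw [this, hA, sub_self, Matrix.zero_mulVec]
  have hζ2 : ζ ^ 2 + ζ + 1 = 0 := by
    apply mul_left_cancel₀ (sub_ne_zero.mpr hζ1)
    linear_combination hζ
  set v₀ := N.mulVec ((ρ a - 1).mulVec u)
  have hv₀ : (ρ a).mulVec v₀ = ζ • v₀ := by
    simp only [v₀]
    rw [Matrix.mulVec_mulVec, hMN, Matrix.smul_mulVec]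
  obtain ⟨η, N', hη, hN', hNu', hMN'⟩ := cube_eig _ hB _ hNu
  have hc : ρ a * N' = N' * ρ a := by
    rw [hN']
    have : ρ a * ρ b ^ 2 = ρ b ^ 2 * ρ a := (show Commute (ρ a) (ρ b) from hAB).pow_right 2
    simp [mul_add, add_mul, hAB, this]
  set v := N'.mulVec v₀
  have hav : (ρ a).mulVec v = ζ • v := by
    simp only [v]
    rw [Matrix.mulVec_mulVec, hc, ← Matrix.mulVec_mulVec, hv₀, Matrix.mulVec_smul]
  have hbv : (ρ b).mulVec v = η • v := by
    simp only [v]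
    rw [Matrix.mulVec_mulVec, hMN', Matrix.smul_mulVec]
  have inv_eig : ∀ (g : G) (k : ℂ), g ^ 3 = 1 → k ^ 3 = 1 → (ρ g).mulVec v = k • v →
      (ρ g⁻¹).mulVec v = k ^ 2 • v := by
    intro g k hg hk h
    have : g⁻¹ = g * g := by
      rw [inv_eq_iff_mul_eq_one, ← hg]; simp [pow_succ, mul_assoc]
    rw [this, map_mul, ← Matrix.mulVec_mulVec, h, Matrix.mulVec_smul, h, smul_smul, pow_two]
  have mul_eig : ∀ (g h : G) (k l : ℂ), (ρ g).mulVec v = k • v → (ρ h).mulVec v = l • v →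
      (ρ (g * h)).mulVec v = (k * l) • v := by
    intro g h k l h1 h2
    rw [map_mul, ← Matrix.mulVec_mulVec, h2, Matrix.mulVec_smul, h1, smul_smul, mul_comm]
  have hcab : Commute a b := hab
  have ha' := inv_eig a ζ ha hζ hav
  have hb' := inv_eig b η hb hη hbv
  have hta' : t * a⁻¹ = b⁻¹ * t := by
    rw [mul_inv_eq_iff_eq_mul, mul_assoc, hta]; group
  have htb' : t * b⁻¹ = a * t := by
    rw [mul_inv_eq_iff_eq_mul, mul_assoc, htb]; group
  have hη3 : η = 1 ∨ η = ζ ∨ η = ζ ^ 2 := by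
    have : (η - 1) * ((η - ζ) * (η - ζ ^ 2)) = 0 := by
      linear_combination hη + (-η ^ 2 + η * ζ ^ 0) * hζ2 + (η - 1) * hζ
    rcases mul_eq_zero.mp this with h | h
    · left; exact sub_eq_zero.mp h
    · rcases mul_eq_zero.mp h with h | h
      · right; left; exact sub_eq_zero.mp h
      · right; right; exact sub_eq_zero.mp h
  rcases hη3 with h | h | h
  · exact ⟨a, b, ζ, v, ha, hb, hta, htb, hζ2, hNu', hav, by rw [hbv, h, one_smul]⟩
  · refine ⟨a * b, a⁻¹ * b, ζ ^ 2, v, ?_, ?_, ?_, ?_, ?_, hNu', ?_, ?_⟩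
    · rw [hcab.mul_pow, ha, hb, one_mul]
    · rw [hcab.inv_left.mul_pow, inv_pow, ha, hb]; simp
    · rw [← mul_assoc, hta, mul_assoc, htb, ← mul_assoc, hcab.inv_left.eq]
    · rw [← mul_assoc, hta', mul_assoc, htb, mul_inv_rev, mul_assoc]
    · linear_combination (ζ ^ 2 - ζ + 1) * hζ2
    · rw [mul_eig _ _ _ _ hav hbv, h, pow_two]
    · rw [mul_eig _ _ _ _ ha' hbv, h, ← pow_succ, hζ, one_smul]
  · refine ⟨a⁻¹ * b, a⁻¹ * b⁻¹, ζ, v, ?_, ?_, ?_, ?_, hζ2, hNu', ?_, ?_⟩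
    · rw [hcab.inv_left.mul_pow, inv_pow, ha, hb]; simp
    · rw [hcab.inv_left.inv_right.mul_pow, inv_pow, inv_pow, ha, hb]; simp
    · rw [← mul_assoc, hta', mul_assoc, htb, ← mul_assoc, hcab.inv_left.inv_right.eq]
    · rw [← mul_assoc, hta', mul_assoc, htb', mul_inv_rev, inv_inv, mul_assoc]
    · rw [mul_eig _ _ _ _ ha' hbv, h]; congr 1; linear_combination ζ * hζ
    · rw [mul_eig _ _ _ _ ha' hb', h]
      have : ζ ^ 2 * (ζ ^ 2) ^ 2 = 1 := by linear_combination (ζ ^ 3 + 1) * hζ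
      rw [this, one_smul]

lemma lin_aux (ζ x y z w : ℂ) (hζ : ζ ^ 2 + ζ + 1 = 0) (f0 : x + y + z + w = 0)
    (f1 : ζ * x + y + ζ ^ 2 * z + w = 0) (f2 : ζ ^ 2 * x + y + ζ ^ 4 * z + w = 0) :
    x = 0 ∧ z = 0 := by
  have hζ3 : ζ ^ 3 - 1 = 0 := by linear_combination (ζ - 1) * hζ
  constructor
  · linear_combination (f0 + ζ ^ 2 * f1 + ζ * f2 - (2 * x + z * (ζ + ζ ^ 2)) * hζ3
      - (y + w + z) * hζ) / 3
  · linear_combination (f0 + ζ * f1 + ζ ^ 2 * f2 - (x * ζ + z * (2 + ζ ^ 3)) * hζ3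
      - (y + w + x) * hζ) / 3

lemma find_basis {G : Type*} [Group G] (ρ : G →* Matrix (Fin 4) (Fin 4) ℂ)
    (hdet : ∀ g, (ρ g).det = 1) (a b t : G) (ζ : ℂ) (v : Fin 4 → ℂ)
    (hb : b ^ 3 = 1) (hta : t * a = b * t)
    (htb : t * b = a⁻¹ * t) (hζ : ζ ^ 2 + ζ + 1 = 0) (hv : v ≠ 0)
    (hav : (ρ a).mulVec v = ζ • v) (hbv : (ρ b).mulVec v = v) :
    ∃ P Q : Matrix (Fin 4) (Fin 4) ℂ, P * Q = 1 ∧ Q * P = 1 ∧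
      ρ a * P = P * Matrix.diagonal ![ζ, 1, ζ ^ 2, 1] ∧
      ρ b * P = P * Matrix.diagonal ![1, ζ, 1, ζ ^ 2] ∧
      ρ t * P = P * !![0, 0, 0, -1; 1, 0, 0, 0; 0, 1, 0, 0; 0, 0, 1, 0] := by
  have hζ3 : ζ ^ 3 = 1 := by linear_combination (ζ - 1) * hζ
  have hζ1 : 1 - ζ ≠ 0 := by
    intro h
    have : ζ = 1 := (sub_eq_zero.mp h).symm
    rw [this] at hζ; norm_num at hζ
  have hζ0 : ζ ≠ 0 := by rintro rfl; norm_num at hζ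
  have htb' : a * t = t * b⁻¹ := by
    rw [eq_mul_inv_iff_mul_eq, mul_assoc, htb]; group
  have hbi : b⁻¹ = b * b := by
    rw [inv_eq_iff_mul_eq_one, ← hb]; simp [pow_succ, mul_assoc]
  have step : ∀ (w : Fin 4 → ℂ) (α β : ℂ), (ρ a).mulVec w = α • w → (ρ b).mulVec w = β • w →
      (ρ a).mulVec ((ρ t).mulVec w) = β ^ 2 • (ρ t).mulVec w ∧
      (ρ b).mulVec ((ρ t).mulVec w) = α • (ρ t).mulVec w := by
    intro w α β h1 h2
    constructor
    · rw [Matrix.mulVec_mulVec, ← map_mul, htb', hbi, map_mul, map_mul, ← Matrix.mulVec_mulVec,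
        ← Matrix.mulVec_mulVec, h2, Matrix.mulVec_smul, h2, Matrix.mulVec_smul,
        Matrix.mulVec_smul, smul_smul, pow_two]
    · rw [Matrix.mulVec_mulVec, ← map_mul, ← hta, map_mul, ← Matrix.mulVec_mulVec, h1,
        Matrix.mulVec_smul]
  have tinj : ∀ w : Fin 4 → ℂ, w ≠ 0 → (ρ t).mulVec w ≠ 0 := by
    intro w hw h
    apply hw
    have := congrArg (ρ t⁻¹).mulVec h
    rw [Matrix.mulVec_mulVec, ← map_mul] at this
    simpa using this
  obtain ⟨v1, hv1⟩ : ∃ w, w = (ρ t).mulVec v := ⟨_, rfl⟩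
  obtain ⟨v2, hv2⟩ : ∃ w, w = (ρ t).mulVec v1 := ⟨_, rfl⟩
  obtain ⟨v3, hv3⟩ : ∃ w, w = (ρ t).mulVec v2 := ⟨_, rfl⟩
  obtain ⟨v4, hv4⟩ : ∃ w, w = (ρ t).mulVec v3 := ⟨_, rfl⟩
  have n1 : v1 ≠ 0 := hv1 ▸ tinj v hv
  have n2 : v2 ≠ 0 := hv2 ▸ tinj v1 n1
  have n3 : v3 ≠ 0 := hv3 ▸ tinj v2 n2
  obtain ⟨a1, b1⟩ := step v ζ 1 hav (by rw [hbv, one_smul])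
  rw [← hv1] at a1 b1
  obtain ⟨a2, b2⟩ := step v1 _ _ a1 b1
  rw [← hv2] at a2 b2
  obtain ⟨a3, b3⟩ := step v2 _ _ a2 b2
  rw [← hv3] at a3 b3
  obtain ⟨a4, b4⟩ := step v3 _ _ a3 b3
  rw [← hv4] at a4 b4
  let P : Matrix (Fin 4) (Fin 4) ℂ := Matrix.of fun i j => (![v, v1, v2, v3] j) i
  have mulP : ∀ (M : Matrix (Fin 4) (Fin 4) ℂ) (i j : Fin 4),
      (M * P) i j = M.mulVec (![v, v1, v2, v3] j) i := fun M i j => rfl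
  have hPA : ρ a * P = P * Matrix.diagonal ![ζ, 1, ζ ^ 2, 1] := by
    ext i j
    rw [mulP, Matrix.mul_diagonal]
    fin_cases j
    · simp [P, hav, mul_comm]
    · simp [P, a1, mul_comm]
    · simp [P, a2, mul_comm]
    · simp [P, a3, mul_comm]
  have hPB : ρ b * P = P * Matrix.diagonal ![1, ζ, 1, ζ ^ 2] := by
    ext i j
    rw [mulP, Matrix.mul_diagonal]
    fin_cases j
    · simp [P, hbv]
    · simp [P, b1, mul_comm]
    · simp [P, b2, mul_comm]
    · simp [P, b3, mul_comm]
  have hP : P.det ≠ 0 := by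
    intro h
    obtain ⟨c, hc, hPc⟩ := Matrix.exists_mulVec_eq_zero_iff.mpr h
    have e1 : (P * Matrix.diagonal ![ζ, 1, ζ ^ 2, 1]).mulVec c = 0 := by
      rw [← hPA, ← Matrix.mulVec_mulVec, hPc, Matrix.mulVec_zero]
    have e2 : (P * Matrix.diagonal ![ζ, 1, ζ ^ 2, 1] *
        Matrix.diagonal ![ζ, 1, ζ ^ 2, 1]).mulVec c = 0 := by
      rw [← hPA, Matrix.mul_assoc, ← hPA, ← Matrix.mulVec_mulVec, ← Matrix.mulVec_mulVec, hPc]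
      simp
    have e3 : (P * Matrix.diagonal ![1, ζ, 1, ζ ^ 2]).mulVec c = 0 := by
      rw [← hPB, ← Matrix.mulVec_mulVec, hPc, Matrix.mulVec_zero]
    have e4 : (P * Matrix.diagonal ![1, ζ, 1, ζ ^ 2] *
        Matrix.diagonal ![1, ζ, 1, ζ ^ 2]).mulVec c = 0 := by
      rw [← hPB, Matrix.mul_assoc, ← hPB, ← Matrix.mulVec_mulVec, ← Matrix.mulVec_mulVec, hPc]
      simp
    have all : ∀ i, c 0 * v i = 0 ∧ c 1 * v1 i = 0 ∧ c 2 * v2 i = 0 ∧ c 3 * v3 i = 0 := by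
      intro i
      have f0 := congrFun hPc i
      have f1 := congrFun e1 i
      have f2 := congrFun e2 i
      have f3 := congrFun e3 i
      have f4 := congrFun e4 i
      simp [Matrix.mulVec, dotProduct, Fin.sum_univ_four, Matrix.mul_diagonal, P] at f0 f1 f2 f3 f4
      have r1 := lin_aux ζ (c 0 * v i) (c 1 * v1 i) (c 2 * v2 i) (c 3 * v3 i) hζ
        (by linear_combination f0) (by linear_combination f1) (by linear_combination f2)
      have r2 := lin_aux ζ (c 1 * v1 i) (c 0 * v i) (c 3 * v3 i) (c 2 * v2 i) hζ
        (by linear_combination f0) (by linear_combination f3) (by linear_combination f4)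
      exact ⟨r1.1, r2.1, r1.2, r2.2⟩
    apply hc
    have z : ∀ (x : ℂ) (w : Fin 4 → ℂ), w ≠ 0 → (∀ i, x * w i = 0) → x = 0 := by
      intro x w hw h
      by_contra hx
      exact hw (funext fun i => (mul_eq_zero.mp (h i)).resolve_left hx)
    funext j
    fin_cases j
    · exact z _ v hv fun i => (all i).1
    · exact z _ v1 n1 fun i => (all i).2.1
    · exact z _ v2 n2 fun i => (all i).2.2.1
    · exact z _ v3 n3 fun i => (all i).2.2.2
  have hu : IsUnit P.det := isUnit_iff_ne_zero.mpr hP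
  have hPQ := Matrix.mul_nonsing_inv P hu
  have hQP := Matrix.nonsing_inv_mul P hu
  refine ⟨P, P⁻¹, hPQ, hQP, hPA, hPB, ?_⟩
  obtain ⟨c, hc⟩ : ∃ c, c = P⁻¹.mulVec v4 := ⟨_, rfl⟩
  have hc' : P.mulVec c = v4 := by rw [hc, Matrix.mulVec_mulVec, hPQ, Matrix.one_mulVec]
  have hDc : (Matrix.diagonal ![ζ, 1, ζ ^ 2, 1]).mulVec c = ζ • c := by
    have h1 : P.mulVec ((Matrix.diagonal ![ζ, 1, ζ ^ 2, 1]).mulVec c) = P.mulVec (ζ • c) := by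
      rw [Matrix.mulVec_mulVec, ← hPA, ← Matrix.mulVec_mulVec, hc', a4, Matrix.mulVec_smul, hc']
      congr 1
      linear_combination ζ * hζ3
    have := congrArg P⁻¹.mulVec h1
    simpa only [Matrix.mulVec_mulVec, hQP, ← Matrix.mul_assoc, Matrix.one_mul,
      Matrix.one_mulVec] using this
  have c1 : c 1 = 0 := by
    have := congrFun hDc 1
    simp [Matrix.mulVec_diagonal] at this
    exact (mul_eq_zero.mp (show (1 - ζ) * c 1 = 0 by linear_combination this)).resolve_left hζ1
  have c2 : c 2 = 0 := by
    have := congrFun hDc 2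
    simp only [Matrix.mulVec_diagonal, Pi.smul_apply, smul_eq_mul] at this
    exact (mul_eq_zero.mp (show (ζ * (1 - ζ)) * c 2 = 0 by
      change ζ ^ 2 * c 2 = _ at this
      linear_combination -this)).resolve_left (mul_ne_zero hζ0 hζ1)
  have c3 : c 3 = 0 := by
    have := congrFun hDc 3
    simp [Matrix.mulVec_diagonal] at this
    exact (mul_eq_zero.mp (show (1 - ζ) * c 3 = 0 by linear_combination this)).resolve_left hζ1
  have hv40 : ∀ i, v4 i = v i * c 0 := by
    intro i
    rw [← hc']
    simp [Matrix.mulVec, dotProduct, Fin.sum_univ_four, P, c1, c2, c3]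
  have hT : ρ t * P = P * !![0, 0, 0, c 0; 1, 0, 0, 0; 0, 1, 0, 0; 0, 0, 1, 0] := by
    ext i j
    rw [mulP, Matrix.mul_apply, Fin.sum_univ_four]
    fin_cases j
    · simp [P, ← hv1]
    · simp [P, ← hv2]
    · simp [P, ← hv3]
    · simp [P, ← hv4, hv40]
  have hd := congrArg Matrix.det hT
  rw [Matrix.det_mul, Matrix.det_mul, hdet, mul_comm] at hd
  have hd1 := mul_left_cancel₀ hP hd
  have : c 0 = -1 := by
    simp [Matrix.det_succ_row_zero, Fin.sum_univ_succ, Fin.succAbove] at hd1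
    linear_combination hd1
  rw [hT, this]

section PolyPart
open MvPolynomial

lemma dvd_homog (p q : MvPolynomial (Fin 4) ℂ) (hp : p.IsHomogeneous 2) (hq : q.IsHomogeneous 2)
    (hq0 : q ≠ 0) (h : p ∣ q) : ∃ k : ℂ, q = k • p := by
  obtain ⟨r, rfl⟩ := h
  have hp0 : p ≠ 0 := left_ne_zero_of_mul hq0
  have hr0 : r ≠ 0 := right_ne_zero_of_mul hq0
  have h1 := totalDegree_mul_of_isDomain hp0 hr0
  rw [hp.totalDegree hp0, hq.totalDegree hq0] at h1
  have h2 : r.totalDegree = 0 := by omega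
  rw [totalDegree_eq_zero_iff_eq_C] at h2
  refine ⟨coeff 0 r, ?_⟩
  rw [smul_eq_C_mul, ← h2, mul_comm]

lemma polyAct_ne_zero (M N : Matrix (Fin 4) (Fin 4) ℂ) (hMN : M * N = 1)
    (p : MvPolynomial (Fin 4) ℂ) (hp : p ≠ 0) : polyAct M p ≠ 0 := by
  intro h
  apply hp
  rw [← polyAct_one p, ← hMN, polyAct_mul, h, polyAct_zero]

lemma sq_scalar (M N : Matrix (Fin 4) (Fin 4) ℂ) (hMN : M * N = 1)
    (q₁ q₂ : MvPolynomial (Fin 4) ℂ) (h1 : q₁.IsHomogeneous 2) (h2 : q₂.IsHomogeneous 2)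
    (hp : Prime q₁) (h20 : q₂ ≠ 0) (c : ℂ)
    (hc : polyAct M (q₁ * q₂) = c • (q₁ * q₂)) :
    ∃ k : ℂ, polyAct (M * M) q₁ = k • q₁ := by
  rw [polyAct_mul_poly] at hc
  have hd : q₁ ∣ polyAct M q₁ * polyAct M q₂ := by
    rw [hc, smul_eq_C_mul]
    exact ⟨C c * q₂, by ring⟩
  rcases hp.dvd_or_dvd hd with h | h
  · obtain ⟨k, hk⟩ := dvd_homog _ _ h1 (polyAct_hom M h1) (polyAct_ne_zero M N hMN _ hp.ne_zero) h
    exact ⟨k * k, by rw [polyAct_mul, hk, polyAct_smul, hk, smul_smul]⟩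
  · obtain ⟨k, hk⟩ := dvd_homog _ _ h1 (polyAct_hom M h2) (polyAct_ne_zero M N hMN _ h20) h
    have hk0 : k ≠ 0 := by
      rintro rfl
      rw [zero_smul] at hk
      exact polyAct_ne_zero M N hMN _ h20 hk
    have h3 : polyAct M q₁ = (k⁻¹ * c) • q₂ := by
      apply mul_right_cancel₀ hp.ne_zero
      rw [hk] at hc
      have : k • (polyAct M q₁ * q₁) = c • (q₁ * q₂) := by rw [← hc, mul_smul_comm]
      rw [mul_smul, smul_mul_assoc, smul_mul_assoc, mul_comm q₂, ← this, smul_smul,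
        inv_mul_cancel₀ hk0, one_smul]
    exact ⟨k⁻¹ * c * k, by rw [polyAct_mul, h3, polyAct_smul, hk, smul_smul]⟩

lemma q_irred : Irreducible (X 0 * X 2 + C Complex.I * X 1 * X 3 : MvPolynomial (Fin 4) ℂ) := by
  apply irreducible_mul_X_add
  · exact X_ne_zero 0
  · simp [vars_X]
  · intro h
    have := vars_mul _ _ h
    simp only [vars_X, Finset.mem_union, Finset.mem_singleton] at this
    rcases this with h | h
    · have := vars_mul _ _ h
      simp [vars_X] at this
    · exact absurd h (by decide)
  · have hirr : Irreducible (X 0 : MvPolynomial (Fin 4) ℂ) := Prime.irreducible X_prime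
    rw [hirr.isRelPrime_iff_not_dvd]
    rintro ⟨r, hr⟩
    have := congrArg (eval ![(0 : ℂ), 1, 1, 1]) hr
    simp at this

lemma polyAct_T (p : MvPolynomial (Fin 4) ℂ) :
    polyAct !![0, 0, 0, -1; 1, 0, 0, 0; 0, 1, 0, 0; 0, 0, 1, 0] p =
      aeval ![-X 3, X 0, X 1, X 2] p := by
  unfold polyAct
  refine DFunLike.congr_fun (?_ : (aeval _ : MvPolynomial (Fin 4) ℂ →ₐ[ℂ] _) = _) p
  apply MvPolynomial.algHom_ext
  intro i
  fin_cases i <;> simp [Fin.sum_univ_four]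

lemma nat2 (p q r s : ℕ) (e : p + q + r + s = 2) (h1 : 3 ∣ p + 2 * r) (h2 : 3 ∣ q + 2 * s) :
    (p = 1 ∧ q = 0 ∧ r = 1 ∧ s = 0) ∨ (p = 0 ∧ q = 1 ∧ r = 0 ∧ s = 1) := by
  have hp : p ≤ 2 := by omega
  have hq : q ≤ 2 := by omega
  have hr : r ≤ 2 := by omega
  interval_cases p <;> interval_cases q <;> interval_cases r <;> omega

lemma nat4 (p q r s : ℕ) (e : p + q + r + s = 4) (h1 : 3 ∣ p + 2 * r) (h2 : 3 ∣ q + 2 * s) :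
    (p = 2 ∧ q = 0 ∧ r = 2 ∧ s = 0) ∨ (p = 0 ∧ q = 2 ∧ r = 0 ∧ s = 2) ∨
      (p = 1 ∧ q = 1 ∧ r = 1 ∧ s = 1) := by
  have hp : p ≤ 4 := by omega
  have hq : q ≤ 4 := by omega
  have hr : r ≤ 4 := by omega
  interval_cases p <;> interval_cases q <;> interval_cases r <;> omega

lemma core {G : Type*} [Group G] (ρ : G →* Matrix (Fin 4) (Fin 4) ℂ) (a b t x y : G)
    (ha : a ^ 3 = 1) (hta : t * a = b * t)
    (htb : t * b = a⁻¹ * t) (ht : t = x ^ 2 * y ^ 2 * (x ^ 2)⁻¹ * (y ^ 2)⁻¹)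
    (ζ : ℂ) (hζ : ζ ^ 2 + ζ + 1 = 0)
    (hA : ρ a = Matrix.diagonal ![ζ, 1, ζ ^ 2, 1])
    (hB : ρ b = Matrix.diagonal ![1, ζ, 1, ζ ^ 2])
    (hT : ρ t = !![0, 0, 0, -1; 1, 0, 0, 0; 0, 1, 0, 0; 0, 0, 1, 0])
    (F : MvPolynomial (Fin 4) ℂ) (d : ℕ) (χ : G →* ℂˣ) (hF : F ≠ 0) (hd : F.IsHomogeneous d)
    (h1 : 1 ≤ d) (h4 : d ≤ 4) (hχ : ∀ g, polyAct (ρ g) F = (χ g : ℂ) • F) : False := by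
  have hζ3 : ζ ^ 3 = 1 := by linear_combination (ζ - 1) * hζ
  have hζ1 : ζ ≠ 1 := by rintro rfl; norm_num at hζ
  have hord : orderOf ζ = 3 := by
    have : Fact (Nat.Prime 3) := ⟨Nat.prime_three⟩
    exact orderOf_eq_prime hζ3 hζ1
  have hχt : χ t = 1 := by
    rw [ht]; simp only [map_mul, map_inv]
    rw [mul_comm (χ (x ^ 2)), mul_inv_cancel_right, mul_inv_cancel]
  have hχab : χ a = χ b := by
    have := congrArg χ hta
    rw [map_mul, map_mul, mul_comm] at this
    exact mul_right_cancel this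
  have hχba : χ b = (χ a)⁻¹ := by
    have := congrArg χ htb
    rw [map_mul, map_mul, mul_comm, map_inv] at this
    exact mul_right_cancel this
  have hχa : χ a = 1 := by
    have h2 : χ a * χ a = 1 := by
      nth_rewrite 2 [hχab]; rw [hχba, mul_inv_cancel]
    have h3 : χ a ^ 3 = 1 := by rw [← map_pow, ha, map_one]
    rw [pow_succ, pow_two, h2, one_mul] at h3
    exact h3
  have hFa : polyAct (Matrix.diagonal ![ζ, 1, ζ ^ 2, 1]) F = F := by
    rw [← hA, hχ, hχa]; simp
  have hFb : polyAct (Matrix.diagonal ![1, ζ, 1, ζ ^ 2]) F = F := by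
    rw [← hB, hχ, ← hχab, hχa]; simp
  have hFt : aeval ![-X 3, X 0, X 1, X 2] F = F := by
    rw [← polyAct_T, ← hT, hχ, hχt]; simp
  have hFn : polyAct (Matrix.diagonal fun _ => (-1 : ℂ)) F = F := by
    have : Matrix.diagonal (fun _ => (-1 : ℂ)) = ρ (t * t * t * t) := by
      simp only [map_mul, hT]
      ext i j
      fin_cases i <;> fin_cases j <;> simp [Matrix.mul_apply, Fin.sum_univ_four]
    rw [this, hχ]; simp [hχt]
  have cond : ∀ m, coeff m F ≠ 0 → m 0 + m 1 + m 2 + m 3 = d ∧ 3 ∣ m 0 + 2 * m 2 ∧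
      3 ∣ m 1 + 2 * m 3 ∧ Even d := by
    intro m hm
    have e0 : m 0 + m 1 + m 2 + m 3 = d := by
      have := hd hm
      rw [Finsupp.weight_apply, Finsupp.sum_fintype _ _ (by simp), Fin.sum_univ_four] at this
      simpa using this
    have ea := congrArg (coeff m) hFa
    have eb := congrArg (coeff m) hFb
    have en := congrArg (coeff m) hFn
    rw [polyAct_diag_coeff, mul_eq_right₀ hm, Fin.prod_univ_four] at ea eb en
    refine ⟨e0, ?_, ?_, ?_⟩
    · refine hord.symm.dvd.trans (orderOf_dvd_of_pow_eq_one ?_)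
      simpa [pow_add, pow_mul] using ea
    · refine hord.symm.dvd.trans (orderOf_dvd_of_pow_eq_one ?_)
      simpa [pow_add, pow_mul] using eb
    · rw [← pow_add, ← pow_add, ← pow_add, e0] at en
      by_contra ho
      rw [Nat.not_even_iff_odd] at ho
      rw [ho.neg_one_pow] at en
      norm_num at en
  obtain ⟨m₀, hm₀⟩ := ne_zero_iff.mp hF
  have hev := (cond m₀ hm₀).2.2.2
  have repr : ∀ S : Finset (Fin 4 →₀ ℕ), (∀ m, coeff m F ≠ 0 → m ∈ S) →
      F = ∑ m ∈ S, monomial m (coeff m F) := by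
    intro S hS
    conv_lhs => rw [F.as_sum]
    apply Finset.sum_subset
    · intro m hm; exact hS m (by simpa using hm)
    · intro m _ hm
      rw [notMem_support_iff.mp hm, monomial_zero]
  have mon : ∀ (w : Fin 4 → ℕ) (r : ℂ), monomial (Finsupp.equivFunOnFinite.symm w) r =
      C r * (X 0 ^ w 0 * X 1 ^ w 1 * X 2 ^ w 2 * X 3 ^ w 3) := by
    intro w r
    rw [monomial_eq, Finsupp.prod_fintype _ _ (by simp), Fin.prod_univ_four]
    simp
  have hd24 : d = 2 ∨ d = 4 := by
    obtain ⟨k, hk⟩ := hev; omega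
  have mext : ∀ (m : Fin 4 →₀ ℕ) (w : Fin 4 → ℕ), m 0 = w 0 → m 1 = w 1 → m 2 = w 2 → m 3 = w 3 →
      m = Finsupp.equivFunOnFinite.symm w := by
    intro m w e0 e1 e2 e3
    ext i
    fin_cases i <;> simpa
  rcases hd24 with rfl | rfl
  · have := repr {Finsupp.equivFunOnFinite.symm ![1, 0, 1, 0],
      Finsupp.equivFunOnFinite.symm ![0, 1, 0, 1]} (by
        intro m hm
        obtain ⟨e0, e1, e2, -⟩ := cond m hm
        rw [Finset.mem_insert, Finset.mem_singleton]
        have : (m 0 = 1 ∧ m 1 = 0 ∧ m 2 = 1 ∧ m 3 = 0) ∨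
          (m 0 = 0 ∧ m 1 = 1 ∧ m 2 = 0 ∧ m 3 = 1) := nat2 _ _ _ _ e0 e1 e2
        rcases this with h | h
        · left; exact mext m _ h.1 h.2.1 h.2.2.1 h.2.2.2
        · right; exact mext m _ h.1 h.2.1 h.2.2.1 h.2.2.2)
    rw [Finset.sum_pair (by
      intro h; simpa using DFunLike.congr_fun h 0), mon, mon] at this
    generalize coeff _ F = α at this
    generalize coeff _ F = β at this
    have h2 : (aeval (![-X 3, X 0, X 1, X 2] : Fin 4 → MvPolynomial (Fin 4) ℂ)
        (aeval (![-X 3, X 0, X 1, X 2] : Fin 4 → MvPolynomial (Fin 4) ℂ) F)) = - F := by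
      rw [this]
      simp [algHom_C, algebraMap_eq]
      ring
    rw [hFt, hFt] at h2
    exact hF (self_eq_neg.mp h2)
  · have := repr {Finsupp.equivFunOnFinite.symm ![2, 0, 2, 0],
      Finsupp.equivFunOnFinite.symm ![0, 2, 0, 2], Finsupp.equivFunOnFinite.symm ![1, 1, 1, 1]} (by
        intro m hm
        obtain ⟨e0, e1, e2, -⟩ := cond m hm
        rw [Finset.mem_insert, Finset.mem_insert, Finset.mem_singleton]
        have : (m 0 = 2 ∧ m 1 = 0 ∧ m 2 = 2 ∧ m 3 = 0) ∨
          (m 0 = 0 ∧ m 1 = 2 ∧ m 2 = 0 ∧ m 3 = 2) ∨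
          (m 0 = 1 ∧ m 1 = 1 ∧ m 2 = 1 ∧ m 3 = 1) := nat4 _ _ _ _ e0 e1 e2
        rcases this with h | h | h
        · left; exact mext m _ h.1 h.2.1 h.2.2.1 h.2.2.2
        · right; left; exact mext m _ h.1 h.2.1 h.2.2.1 h.2.2.2
        · right; right; exact mext m _ h.1 h.2.1 h.2.2.1 h.2.2.2)
    rw [Finset.sum_insert (by
      rw [Finset.mem_insert, Finset.mem_singleton]
      rintro (h | h) <;> simpa using DFunLike.congr_fun h 0), Finset.sum_pair (by
      intro h; simpa using DFunLike.congr_fun h 0), mon, mon, mon] at this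
    generalize coeff _ F = α at this
    generalize coeff _ F = β at this
    generalize coeff _ F = γ at this
    have hFt' := hFt
    rw [this] at hFt'
    have e1 := congrArg (eval ![1, 0, 1, 0]) hFt'
    have e2 := congrArg (eval ![1, 1, 1, 1]) hFt'
    simp [algHom_C, algebraMap_eq] at e1 e2
    have hγ : γ = 0 := by linear_combination (-1 / 2 : ℂ) * e2
    obtain ⟨q₁, hq₁⟩ : ∃ q : MvPolynomial (Fin 4) ℂ, q = X 0 * X 2 + C Complex.I * X 1 * X 3 :=
      ⟨_, rfl⟩
    obtain ⟨q₂, hq₂⟩ : ∃ q : MvPolynomial (Fin 4) ℂ, q = X 0 * X 2 - C Complex.I * X 1 * X 3 :=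
      ⟨_, rfl⟩
    have hFq : F = α • (q₁ * q₂) := by
      have hI : (C Complex.I : MvPolynomial (Fin 4) ℂ) * C Complex.I = -1 := by
        rw [← C_mul, Complex.I_mul_I]; simp
      rw [this, hγ, e1, hq₁, hq₂, smul_eq_C_mul]
      simp
      linear_combination (C α * X 1 ^ 2 * X 3 ^ 2) * hI
    have hα : α ≠ 0 := by
      rintro rfl; rw [zero_smul] at hFq; exact hF hFq
    have hq20 : q₂ ≠ 0 := by
      rintro rfl; rw [mul_zero, smul_zero] at hFq; exact hF hFq
    have hp : Prime q₁ := by rw [hq₁]; exact q_irred.prime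
    have hX2 : ∀ i j : Fin 4, (X i * X j : MvPolynomial (Fin 4) ℂ).IsHomogeneous 2 := fun i j =>
      (isHomogeneous_X ℂ i).mul (isHomogeneous_X ℂ j)
    have hCX : (C Complex.I * X 1 * X 3 : MvPolynomial (Fin 4) ℂ).IsHomogeneous 2 := by
      rw [mul_assoc]; simpa using (isHomogeneous_C (Fin 4) Complex.I).mul (hX2 1 3)
    have hh1 : q₁.IsHomogeneous 2 := by rw [hq₁]; exact (hX2 0 2).add hCX
    have hh2 : q₂.IsHomogeneous 2 := by rw [hq₂]; exact (hX2 0 2).sub hCX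
    have hsq : ∀ g : G, ∃ k : ℂ, polyAct (ρ (g ^ 2)) q₁ = k • q₁ := by
      intro g
      rw [pow_two, map_mul]
      refine sq_scalar (ρ g) (ρ g⁻¹) (by rw [← map_mul]; simp) q₁ q₂ hh1 hh2 hp hq20 (χ g) ?_
      have := hχ g
      rw [hFq, polyAct_smul, smul_comm] at this
      exact smul_right_injective _ hα this
    obtain ⟨k, hk⟩ := hsq x
    obtain ⟨l, hl⟩ := hsq y
    obtain ⟨k', hk'⟩ := hsq x⁻¹
    obtain ⟨l', hl'⟩ := hsq y⁻¹
    have inv1 : ∀ (g : G) (k k' : ℂ), polyAct (ρ (g ^ 2)) q₁ = k • q₁ →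
        polyAct (ρ (g⁻¹ ^ 2)) q₁ = k' • q₁ → k * k' = 1 := by
      intro g k k' h h'
      have : polyAct (ρ (g ^ 2 * g⁻¹ ^ 2)) q₁ = (k * k') • q₁ := by
        rw [map_mul, polyAct_mul, h, polyAct_smul, h', smul_smul]
      rw [inv_pow, mul_inv_cancel, map_one, polyAct_one] at this
      have h0 : (k * k' - 1) • q₁ = 0 := by rw [sub_smul, ← this, one_smul, sub_self]
      rcases smul_eq_zero.mp h0 with h | h
      · exact sub_eq_zero.mp h
      · exact absurd h hp.ne_zero
    have hkk := inv1 x k k' hk hk'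
    have hll := inv1 y l l' hl hl'
    have r1 : polyAct (ρ t) q₁ = q₁ := by
      rw [ht, ← inv_pow, ← inv_pow]
      simp only [map_mul, polyAct_mul]
      simp only [hk, hl, hk', hl', polyAct_smul, smul_smul]
      rw [show k * l * k' * l' = 1 by linear_combination l * l' * hkk + hll, one_smul]
    rw [hT, polyAct_T, hq₁] at r1
    have := congrArg (eval ![1, 0, 1, 0]) r1
    simp at this
    have := congrArg Complex.re this
    simp at this


end PolyPart

/-- A finite subgroup `G ≤ SL(4,ℂ)` containing `-I`, with `G/{±I} ≅ A₆` and with the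
tautological action on `ℂ⁴` irreducible, has no semi-invariants of degree at most `4`. -/
theorem stmt_2 (G : Subgroup (Matrix.SpecialLinearGroup (Fin 4) ℂ)) [Finite G]
    (hneg : negId ∈ G)
    (hquot : ∃ φ : G →* alternatingGroup (Fin 6),
      Function.Surjective φ ∧ φ.ker = Subgroup.zpowers (⟨negId, hneg⟩ : G))
    (hirr : ∀ W : Submodule ℂ (Fin 4 → ℂ),
      (∀ g : G, ∀ v ∈ W,
        ((g : Matrix.SpecialLinearGroup (Fin 4) ℂ) : Matrix (Fin 4) (Fin 4) ℂ).mulVec v ∈ W) →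
      W = ⊥ ∨ W = ⊤) :
    ¬ ∃ (f : MvPolynomial (Fin 4) ℂ) (d : ℕ) (χ : G →* ℂˣ),
        f ≠ 0 ∧ f.IsHomogeneous d ∧ 1 ≤ d ∧ d ≤ 4 ∧
        ∀ g : G,
          polyAct ((g⁻¹ : Matrix.SpecialLinearGroup (Fin 4) ℂ) : Matrix (Fin 4) (Fin 4) ℂ) f
            = (χ g : ℂ) • f := by
  classical
  rintro ⟨f, d, χ, hf, hd, h1, h4, hχ⟩
  obtain ⟨φ, hs, hk⟩ := hquot
  have hz : ∀ g : G, g * ⟨negId, hneg⟩ = ⟨negId, hneg⟩ * g := by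
    intro g
    apply Subtype.ext
    apply Subtype.ext
    change (g : Matrix.SpecialLinearGroup (Fin 4) ℂ).1 * (-1) = (-1) * _
    simp
  have hz2 : (⟨negId, hneg⟩ : G) * ⟨negId, hneg⟩ = 1 := by
    apply Subtype.ext
    apply Subtype.ext
    change (-1 : Matrix (Fin 4) (Fin 4) ℂ) * (-1) = 1
    simp
  obtain ⟨a, b, t, x, y, ha, hb, hab, hta, htb, hne, ht⟩ := grp_aux _ hz hz2 φ hs hk
  let ρ : G →* Matrix (Fin 4) (Fin 4) ℂ :=
    { toFun := fun g => (g : Matrix.SpecialLinearGroup (Fin 4) ℂ).1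
      map_one' := rfl
      map_mul' := fun _ _ => rfl }
  have hdet : ∀ g, (ρ g).det = 1 := fun g => (g : Matrix.SpecialLinearGroup (Fin 4) ℂ).2
  have hρa : ρ a ≠ 1 := fun h => hne (Subtype.ext (Subtype.ext h))
  obtain ⟨a, b, ζ, v, ha, hb, hta, htb, hζ, hv, hav, hbv⟩ :=
    find_eig ρ a b t ha hb hab hta htb hρa
  obtain ⟨P, Q, hPQ, hQP, hPA, hPB, hPT⟩ :=
    find_basis ρ hdet a b t ζ v hb hta htb hζ hv hav hbv
  let ρ' : G →* Matrix (Fin 4) (Fin 4) ℂ :=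
    { toFun := fun g => Q * (ρ g * P)
      map_one' := by rw [map_one, one_mul, hQP]
      map_mul' := fun g h => by
        rw [map_mul]
        calc Q * (ρ g * ρ h * P) = Q * (ρ g * (1 * (ρ h * P))) := by
              simp only [Matrix.one_mul, Matrix.mul_assoc]
          _ = _ := by rw [← hPQ]; simp only [Matrix.mul_assoc] }
  have hconj : ∀ g D, ρ g * P = P * D → ρ' g = D := by
    intro g D h
    change Q * (ρ g * P) = D
    rw [h, ← Matrix.mul_assoc, hQP, Matrix.one_mul]
  refine core ρ' a b t x y ha hta htb ht ζ hζ (hconj _ _ hPA) (hconj _ _ hPB) (hconj _ _ hPT)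
    (polyAct P f) d χ⁻¹ (polyAct_ne_zero P Q hPQ f hf) (polyAct_hom P hd) h1 h4 ?_
  intro g
  change polyAct (Q * (ρ g * P)) (polyAct P f) = _
  rw [← polyAct_mul, ← Matrix.mul_assoc, hPQ, Matrix.one_mul, polyAct_mul]
  have h := hχ g⁻¹
  have hg : ((((g⁻¹ : G) : Matrix.SpecialLinearGroup (Fin 4) ℂ)⁻¹ :
      Matrix.SpecialLinearGroup (Fin 4) ℂ) : Matrix (Fin 4) (Fin 4) ℂ) = ρ g := by
    rw [InvMemClass.coe_inv, inv_inv]; rfl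
  rw [hg] at h
  rw [h, polyAct_smul]
  simp
end

section
/- Let G be a finite subgroup of SL(4,ℂ) such that the scalar matrix −I belongs to G, the quotient G/{±I} is isomorphic either to the symmetric group S₆ or to the alternating group A₇, and the tautological action of G on ℂ⁴ is irreducible. Then G has no semi-invariants of degree at most 4: there is no nonzero homogeneous polynomial f ∈ ℂ[x₁,x₂,x₃,x₄] with 1 ≤ deg f ≤ 4 and a group homomorphism χ : G → ℂˣ such that g·f = χ(g)·f for all g ∈ G. -/
open MvPolynomial in
noncomputable def polyActHom (g : Matrix (Fin 4) (Fin 4) ℂ) :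
    MvPolynomial (Fin 4) ℂ →ₐ[ℂ] MvPolynomial (Fin 4) ℂ :=
  MvPolynomial.aeval fun i => ∑ j, MvPolynomial.C (g i j) * MvPolynomial.X j

theorem polyAct_eq (g : Matrix (Fin 4) (Fin 4) ℂ) (f) : polyAct g f = polyActHom g f := rfl

theorem pa_X (g : Matrix (Fin 4) (Fin 4) ℂ) (i) :
    polyActHom g (MvPolynomial.X i) = ∑ j, MvPolynomial.C (g i j) * MvPolynomial.X j := by
  simp [polyActHom]

theorem pa_C (g : Matrix (Fin 4) (Fin 4) ℂ) (c) :
    polyActHom g (MvPolynomial.C c) = MvPolynomial.C c := by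
  simp [polyActHom]

theorem pa_mul (g h : Matrix (Fin 4) (Fin 4) ℂ) (f) :
    polyActHom (g * h) f = polyActHom h (polyActHom g f) := by
  have : polyActHom (g * h) = (polyActHom h).comp (polyActHom g) := by
    apply MvPolynomial.algHom_ext
    intro i
    rw [AlgHom.comp_apply, pa_X, pa_X, map_sum]
    simp only [map_mul, pa_X, pa_C, Matrix.mul_apply, map_sum, Finset.sum_mul, Finset.mul_sum,
      mul_assoc]
    rw [Finset.sum_comm]
  rw [this]; rfl

theorem pa_diag (w : Fin 4 → ℂ) (f m) :
    MvPolynomial.coeff m (polyActHom (Matrix.diagonal w) f) = (∏ i, w i ^ m i) * f.coeff m := by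
  have h1 : ∀ i, polyActHom (Matrix.diagonal w) (MvPolynomial.X i) =
      MvPolynomial.C (w i) * MvPolynomial.X i := by
    intro i
    rw [pa_X, Finset.sum_eq_single i]
    · simp
    · intro j _ hj
      simp [Matrix.diagonal_apply_ne' _ hj]
    · simp
  induction f using MvPolynomial.induction_on' with
  | add p q hp hq => simp [hp, hq, mul_add]
  | monomial u a =>
    rw [MvPolynomial.monomial_eq, map_mul, pa_C, Finsupp.prod_fintype _ _ (by simp), map_prod]
    simp only [map_pow, h1, mul_pow, Finset.prod_mul_distrib]
    have : (∏ i, (MvPolynomial.C (w i) : MvPolynomial (Fin 4) ℂ) ^ u i)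
      = MvPolynomial.C (∏ i, w i ^ u i) := by simp
    have e2 : MvPolynomial.C a * ∏ i, (MvPolynomial.X i : MvPolynomial (Fin 4) ℂ) ^ u i
      = MvPolynomial.monomial u a := by
      rw [MvPolynomial.monomial_eq, Finsupp.prod_fintype _ _ (by simp)]
    rw [this, mul_left_comm, e2, MvPolynomial.coeff_C_mul, MvPolynomial.coeff_monomial]
    split_ifs with h
    · rw [h]
    · simp

theorem pa_one (f) : polyActHom 1 f = f := by
  have : polyActHom 1 = AlgHom.id ℂ _ := by
    apply MvPolynomial.algHom_ext
    intro i
    rw [pa_X, Finset.sum_eq_single i]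
    · simp
    · intro j _ hj
      simp [Matrix.one_apply_ne' hj]
    · simp
  rw [this]; rfl

theorem pa_hom (g : Matrix (Fin 4) (Fin 4) ℂ) {f d} (h : MvPolynomial.IsHomogeneous f d) :
    (polyActHom g f).IsHomogeneous d := by
  have := h.aeval (S := ℂ) (n := 1) (fun i => ∑ j, MvPolynomial.C (g i j) * MvPolynomial.X j) (by
    intro i
    apply MvPolynomial.IsHomogeneous.sum
    intro j _
    exact (MvPolynomial.isHomogeneous_C_mul_X _ _))
  rw [one_mul] at this
  exact this

theorem pa_neg {f d} (h : MvPolynomial.IsHomogeneous f d) :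
    polyActHom (-1) f = (-1 : ℂ) ^ d • f := by
  have e : (-1 : Matrix (Fin 4) (Fin 4) ℂ) = Matrix.diagonal (fun _ => -1) := by
    rw [← Matrix.diagonal_one, ← Matrix.diagonal_neg]
  ext m
  rw [e, pa_diag, MvPolynomial.coeff_smul, smul_eq_mul]
  by_cases hm : f.coeff m = 0
  · simp [hm]
  · have := h hm
    rw [Finset.prod_pow_eq_pow_sum, ← this, Finsupp.weight_apply, Finsupp.sum_fintype _ _ (by simp)]
    simp

noncomputable def qP (s : ℂ) : MvPolynomial (Fin 4) ℂ :=
  MvPolynomial.X 2 * MvPolynomial.X 0 +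
    MvPolynomial.C s * (MvPolynomial.X 1 * MvPolynomial.X 3)

theorem qP_prime (s : ℂ) (hs : s ≠ 0) : Prime (qP s) := by
  rw [← UniqueFactorizationMonoid.irreducible_iff_prime]
  apply MvPolynomial.irreducible_mul_X_add
  · exact MvPolynomial.X_ne_zero _
  · simp [MvPolynomial.vars_X]
  · intro h
    have := MvPolynomial.vars_mul _ _ h
    rw [MvPolynomial.vars_C, Finset.mem_union] at this
    have := this.resolve_left (by simp)
    have := MvPolynomial.vars_mul _ _ this
    simp [MvPolynomial.vars_X] at this
  · rw [Irreducible.isRelPrime_iff_not_dvd]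
    · rintro ⟨q, hq⟩
      have := congrArg (MvPolynomial.eval ![1,1,0,1]) hq
      simp at this
      exact hs this
    · exact (MvPolynomial.X_prime).irreducible

theorem qP_hom (s : ℂ) : (qP s).IsHomogeneous 2 := by
  apply MvPolynomial.IsHomogeneous.add
  · exact (MvPolynomial.isHomogeneous_X _ _).mul (MvPolynomial.isHomogeneous_X _ _)
  · have := (MvPolynomial.isHomogeneous_C (Fin 4) s).mul ((MvPolynomial.isHomogeneous_X ℂ (1 : Fin 4)).mul (MvPolynomial.isHomogeneous_X ℂ (3 : Fin 4)))
    simpa using this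

theorem dvd_const {p q : MvPolynomial (Fin 4) ℂ} {d : ℕ} (hp : p.IsHomogeneous d)
    (hq : q.IsHomogeneous d) (hq0 : q ≠ 0) (h : p ∣ q) : ∃ c : ℂ, q = c • p := by
  obtain ⟨r, rfl⟩ := h
  have hp0 : p ≠ 0 := left_ne_zero_of_mul hq0
  have hr0 : r ≠ 0 := right_ne_zero_of_mul hq0
  have := MvPolynomial.totalDegree_mul_of_isDomain hp0 hr0
  rw [hq.totalDegree hq0, hp.totalDegree hp0] at this
  have h0 : r.totalDegree = 0 := by omega
  rw [MvPolynomial.totalDegree_eq_zero_iff_eq_C] at h0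
  exact ⟨r.coeff 0, by rw [h0, MvPolynomial.smul_eq_C_mul, mul_comm]; simp⟩

/-- An order three matrix preserving `P Q` up to scalar preserves `P` up to a cube root of 1. -/
theorem pa_stab (X : Matrix (Fin 4) (Fin 4) ℂ) (hX : X ^ 3 = 1) (μ : ℂ)
    (h : polyActHom X (qP Complex.I * qP (-Complex.I)) =
      μ • (qP Complex.I * qP (-Complex.I))) :
    ∃ c : ℂ, c ^ 3 = 1 ∧ polyActHom X (qP Complex.I) = c • qP Complex.I := by
  have hP := qP_prime Complex.I Complex.I_ne_zero
  have hQ := qP_prime (-Complex.I) (neg_ne_zero.2 Complex.I_ne_zero)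
  have h3 : ∀ f, polyActHom X (polyActHom X (polyActHom X f)) = f := by
    intro f
    rw [← pa_mul, ← pa_mul, ← pow_two, ← pow_succ', hX, pa_one]
  have hinj : ∀ f, f ≠ 0 → polyActHom X f ≠ 0 := by
    intro f hf h0
    apply hf
    rw [← h3 f, h0, map_zero, map_zero]
  set P := qP Complex.I with hPdef
  set Q := qP (-Complex.I) with hQdef
  have hd : P ∣ polyActHom X P * polyActHom X Q := by
    rw [← map_mul, h]
    exact ⟨μ • Q, by rw [mul_smul_comm]⟩
  rcases hP.dvd_or_dvd hd with h1 | h1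
  · obtain ⟨c, hc⟩ := dvd_const (qP_hom _) (pa_hom X (qP_hom _)) (hinj _ hP.ne_zero) h1
    refine ⟨c, ?_, hc⟩
    have := h3 P
    rw [hc, map_smul, hc, map_smul, map_smul, hc, smul_smul, smul_smul] at this
    have h' : (c * c * c - 1) • P = 0 := by rw [sub_smul, one_smul, this, sub_self]
    have := (smul_eq_zero.1 h').resolve_right hP.ne_zero
    linear_combination this
  · exfalso
    obtain ⟨c, hc⟩ := dvd_const (qP_hom _) (pa_hom X (qP_hom _)) (hinj _ hQ.ne_zero) h1
    have h2 : c • polyActHom X P = μ • Q := by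
      apply mul_left_cancel₀ hP.ne_zero
      rw [map_mul, hc] at h
      rw [mul_smul_comm, mul_smul_comm, ← h, mul_smul_comm, mul_comm]
    -- apply X twice more
    have h4 := congrArg (polyActHom X) h2
    rw [map_smul, map_smul, hc] at h4
    have h5 := congrArg (polyActHom X) h4
    rw [map_smul, map_smul, map_smul, h3] at h5
    have h6 : (c * c) • P = (μ * c * μ) • Q := by
      rw [mul_smul, h5, smul_comm c μ, smul_comm c c, h2]
      simp only [smul_smul]; ring_nf
    have c0 : c ≠ 0 := by
      rintro rfl
      rw [zero_smul] at hc
      exact hinj _ hQ.ne_zero hc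
    have e1 := congrArg (MvPolynomial.eval ![1,0,1,0]) h6
    have e2 := congrArg (MvPolynomial.eval ![0,1,0,1]) h6
    simp [hPdef, hQdef, qP] at e1 e2
    have : (c * c) * Complex.I = 0 := by linear_combination (e2 + Complex.I * e1) / 2
    simp [c0] at this
def matT (s : ℂ) : Matrix (Fin 4) (Fin 4) ℂ := !![0,0,0,s; 1,0,0,0; 0,1,0,0; 0,0,1,0]

theorem matT_det (s : ℂ) : (matT s).det = -s := by
  simp [matT, Matrix.det_succ_row_zero, Fin.sum_univ_succ, Fin.succAbove]
  ring

theorem matT_qP : polyActHom (matT (-1)) (qP Complex.I) = Complex.I • qP Complex.I := by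
  have hI : (MvPolynomial.C Complex.I * MvPolynomial.C Complex.I : MvPolynomial (Fin 4) ℂ)
      = -1 := by rw [← map_mul, Complex.I_mul_I]; simp
  simp only [qP, map_add, map_mul, pa_X, pa_C, Fin.sum_univ_four, MvPolynomial.smul_eq_C_mul]
  simp [matT]
  linear_combination (-MvPolynomial.X 1 * MvPolynomial.X 3) * hI

theorem mod3 {ζ : ℂ} (h3 : ζ ^ 3 = 1) (h1 : ζ ≠ 1) {n : ℕ} (h : ζ ^ n = 1) : 3 ∣ n := by
  have : orderOf ζ = 3 := orderOf_eq_prime h3 h1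
  rw [← this]; exact orderOf_dvd_of_pow_eq_one h

theorem F_coeff {ζ : ℂ} (h3 : ζ ^ 3 = 1) (h1 : ζ ≠ 1) {F : MvPolynomial (Fin 4) ℂ}
    (hC : polyActHom (Matrix.diagonal ![ζ, 1, ζ ^ 2, 1]) F = F)
    (hD : polyActHom (Matrix.diagonal ![1, ζ, 1, ζ ^ 2]) F = F) {m} (hm : F.coeff m ≠ 0) :
    3 ∣ m 0 + 2 * m 2 ∧ 3 ∣ m 1 + 2 * m 3 := by
  constructor
  · have := congrArg (MvPolynomial.coeff m) hC
    rw [pa_diag] at this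
    have := (mul_eq_right₀ hm).1 this
    simp [Fin.prod_univ_four, ← pow_mul, ← pow_add] at this
    exact mod3 h3 h1 this
  · have := congrArg (MvPolynomial.coeff m) hD
    rw [pa_diag] at this
    have := (mul_eq_right₀ hm).1 this
    simp [Fin.prod_univ_four, ← pow_mul, ← pow_add] at this
    exact mod3 h3 h1 this

noncomputable def mm (i j : ℕ) : Fin 4 →₀ ℕ := Finsupp.equivFunOnFinite.symm ![i, j, i, j]

theorem mono_mm (i j : ℕ) (c : ℂ) : MvPolynomial.monomial (mm i j) c =
    MvPolynomial.C c * ((MvPolynomial.X 0 * MvPolynomial.X 2) ^ i *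
      (MvPolynomial.X 1 * MvPolynomial.X 3) ^ j) := by
  rw [MvPolynomial.monomial_eq, Finsupp.prod_fintype _ _ (by simp)]
  simp [Fin.prod_univ_four, mm]
  left
  ring

theorem F_form {F : MvPolynomial (Fin 4) ℂ} (S : Finset (Fin 4 →₀ ℕ))
    (h : ∀ m, F.coeff m ≠ 0 → m ∈ S) : F = ∑ m ∈ S, MvPolynomial.monomial m (F.coeff m) := by
  conv_lhs => rw [F.as_sum]
  apply Finset.sum_subset
  · intro m hm; exact h m (MvPolynomial.mem_support_iff.1 hm)
  · intro m _ hm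
    simp [MvPolynomial.notMem_support_iff.1 hm]

theorem mm_eq {m : Fin 4 →₀ ℕ} {i j : ℕ} (h0 : m 0 = i) (h1 : m 1 = j) (h2 : m 2 = i)
    (h3 : m 3 = j) : m = mm i j := by
  ext k; fin_cases k <;> simp [mm, *]

theorem mm_inj {i j k l : ℕ} (h : i ≠ k) : mm i j ≠ mm k l := by
  intro e
  apply h
  have := DFunLike.congr_fun e 0
  simpa [mm] using this

theorem core_diag {ζ : ℂ} (h3 : ζ ^ 3 = 1) (h1 : ζ ≠ 1) {F : MvPolynomial (Fin 4) ℂ} {d : ℕ}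
    (hF : F ≠ 0) (hh : F.IsHomogeneous d) (hd : d = 2 ∨ d = 4)
    (hC : polyActHom (Matrix.diagonal ![ζ, 1, ζ ^ 2, 1]) F = F)
    (hD : polyActHom (Matrix.diagonal ![1, ζ, 1, ζ ^ 2]) F = F)
    (X Y : Matrix (Fin 4) (Fin 4) ℂ) (hX : X ^ 3 = 1) (hY : Y ^ 3 = 1) (hT : X * Y = matT (-1))
    (μ ν : ℂ) (hμ : μ ^ 3 = 1) (hν : ν ^ 3 = 1) (hXF : polyActHom X F = μ • F)
    (hYF : polyActHom Y F = ν • F) : False := by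
  have hκ : (μ * ν) ^ 3 = 1 := by rw [mul_pow, hμ, hν, one_mul]
  have hTF : polyActHom (matT (-1)) F = (μ * ν) • F := by
    rw [← hT, pa_mul, hXF, map_smul, hYF, smul_smul]
  have hdeg : ∀ m, F.coeff m ≠ 0 → m 0 + m 1 + m 2 + m 3 = d := by
    intro m hm
    have := hh hm
    rw [Finsupp.weight_apply, Finsupp.sum_fintype _ _ (by simp)] at this
    simpa [Fin.sum_univ_four] using this
  generalize hκ' : μ * ν = κ at *
  rcases hd with rfl | rfl
  · have hf := F_form {mm 1 0, mm 0 1} (by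
      intro m hm
      have a1 := hdeg m hm
      have ⟨a2, a3⟩ := F_coeff h3 h1 hC hD hm
      have : (m 0 = 1 ∧ m 1 = 0 ∧ m 2 = 1 ∧ m 3 = 0) ∨ (m 0 = 0 ∧ m 1 = 1 ∧ m 2 = 0 ∧ m 3 = 1) := by
        generalize m 0 = n0 at *
        generalize m 1 = n1 at *
        generalize m 2 = n2 at *
        generalize m 3 = n3 at *
        have l2 : n2 ≤ 4 := by omega
        have l3 : n3 ≤ 4 := by omega
        clear hm
        interval_cases n2 <;> interval_cases n3 <;> omega
      rcases this with ⟨b0, b1, b2, b3⟩ | ⟨b0, b1, b2, b3⟩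
      · simp [mm_eq b0 b1 b2 b3]
      · simp [mm_eq b0 b1 b2 b3])
    rw [Finset.sum_pair (mm_inj (by norm_num)), mono_mm, mono_mm] at hf
    generalize F.coeff (mm 1 0) = α at hf
    generalize F.coeff (mm 0 1) = β at hf
    have e1 := congrArg (MvPolynomial.eval ![1,0,1,0]) hTF
    have e2 := congrArg (MvPolynomial.eval ![0,1,0,1]) hTF
    simp [hf, pa_X, Fin.sum_univ_four, matT] at e1 e2
    have hα : α = 0 := by
      by_contra hα
      have h2 : κ ^ 2 = -1 := by
        apply mul_right_cancel₀ hα; rw [e1] at e2; linear_combination -e2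
      have h5 : κ = -1 := by linear_combination κ * h2 - hκ
      rw [h5] at h2; norm_num at h2
    rw [hα, mul_zero] at e1
    apply hF; rw [hf, e1, hα]; simp
  · have hf := F_form {mm 2 0, mm 1 1, mm 0 2} (by
      intro m hm
      have a1 := hdeg m hm
      have ⟨a2, a3⟩ := F_coeff h3 h1 hC hD hm
      have : (m 0 = 2 ∧ m 1 = 0 ∧ m 2 = 2 ∧ m 3 = 0) ∨ (m 0 = 1 ∧ m 1 = 1 ∧ m 2 = 1 ∧ m 3 = 1) ∨
          (m 0 = 0 ∧ m 1 = 2 ∧ m 2 = 0 ∧ m 3 = 2) := by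
        generalize m 0 = n0 at *
        generalize m 1 = n1 at *
        generalize m 2 = n2 at *
        generalize m 3 = n3 at *
        have l2 : n2 ≤ 4 := by omega
        have l3 : n3 ≤ 4 := by omega
        clear hm
        interval_cases n2 <;> interval_cases n3 <;> omega
      rcases this with ⟨b0, b1, b2, b3⟩ | ⟨b0, b1, b2, b3⟩ | ⟨b0, b1, b2, b3⟩
      · simp [mm_eq b0 b1 b2 b3]
      · simp [mm_eq b0 b1 b2 b3]
      · simp [mm_eq b0 b1 b2 b3])
    rw [Finset.sum_insert (by simp [mm_inj]), Finset.sum_pair (mm_inj (by norm_num)),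
      mono_mm, mono_mm, mono_mm] at hf
    generalize F.coeff (mm 2 0) = α at hf
    generalize F.coeff (mm 1 1) = β at hf
    generalize F.coeff (mm 0 2) = γ at hf
    have e1 := congrArg (MvPolynomial.eval ![1,0,1,0]) hTF
    have e2 := congrArg (MvPolynomial.eval ![0,1,0,1]) hTF
    have e3 := congrArg (MvPolynomial.eval ![1,1,1,1]) hTF
    simp [hf, pa_X, Fin.sum_univ_four, matT] at e1 e2 e3
    have hβ : β = 0 := by
      by_contra hβ
      have h2 : κ = -1 := by
        apply mul_right_cancel₀ hβ; linear_combination e1 + e2 - e3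
      rw [h2] at hκ; norm_num at hκ
    have hα : α ≠ 0 := by
      intro hα
      rw [hα, mul_zero] at e1
      apply hF; rw [hf, e1, hα, hβ]; simp
    have h2 : κ ^ 2 = 1 := by
      apply mul_right_cancel₀ hα; rw [e1] at e2; linear_combination -e2
    have h5 : κ = 1 := by linear_combination hκ - κ * h2
    rw [h5, one_mul] at e1
    have hPQ : F = α • (qP Complex.I * qP (-Complex.I)) := by
      have hI : (MvPolynomial.C Complex.I * MvPolynomial.C Complex.I : MvPolynomial (Fin 4) ℂ)
        = -1 := by rw [← map_mul, Complex.I_mul_I]; simp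
      rw [hf, e1, hβ, MvPolynomial.smul_eq_C_mul, qP, qP, map_zero, map_neg]
      linear_combination (MvPolynomial.C α * (MvPolynomial.X 1 * MvPolynomial.X 3) ^ 2) * hI
    have key : ∀ (Z : Matrix (Fin 4) (Fin 4) ℂ) (ρ : ℂ), polyActHom Z F = ρ • F →
        polyActHom Z (qP Complex.I * qP (-Complex.I)) = ρ • (qP Complex.I * qP (-Complex.I)) := by
      intro Z ρ hZ
      rw [hPQ, map_smul, smul_comm] at hZ
      exact smul_right_injective _ hα hZ
    obtain ⟨c, hc, hcP⟩ := pa_stab X hX μ (key X μ hXF)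
    obtain ⟨c', hc', hcP'⟩ := pa_stab Y hY ν (key Y ν hYF)
    have hh := matT_qP
    rw [← hT, pa_mul, hcP, map_smul, hcP', smul_smul] at hh
    have h7 : c * c' = Complex.I :=
      smul_left_injective ℂ (qP_prime Complex.I Complex.I_ne_zero).ne_zero hh
    have h8 : (c * c') ^ 3 = 1 := by rw [mul_pow, hc, hc', one_mul]
    rw [h7, Complex.I_pow_three] at h8
    have := congrArg Complex.re h8
    simp at this
open Matrix in
theorem exists_eig (N : Matrix (Fin 4) (Fin 4) ℂ) (h : N ^ 3 = 1) (W : Submodule ℂ (Fin 4 → ℂ))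
    (hW : ∀ v ∈ W, N *ᵥ v ∈ W) (w : Fin 4 → ℂ) (hw : w ∈ W) (hw0 : w ≠ 0) :
    ∃ u ∈ W, u ≠ 0 ∧ ∃ l : ℂ, l ^ 3 = 1 ∧ N *ᵥ u = l • u := by
  let f : Module.End ℂ W := (Matrix.toLin' N).restrict hW
  have : Nontrivial W := ⟨⟨⟨w, hw⟩, 0, by simpa [Subtype.ext_iff] using hw0⟩⟩
  obtain ⟨l, hl⟩ := Module.End.exists_eigenvalue f
  obtain ⟨u, hu⟩ := hl.exists_hasEigenvector
  have hu1 : N *ᵥ (u : Fin 4 → ℂ) = l • (u : Fin 4 → ℂ) := by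
    have := congrArg Subtype.val hu.apply_eq_smul
    exact this
  have hu0 : (u : Fin 4 → ℂ) ≠ 0 := by simpa using hu.2
  refine ⟨u, u.2, hu0, l, ?_, hu1⟩
  have h3 : N ^ 3 *ᵥ (u : Fin 4 → ℂ) = (l ^ 3) • (u : Fin 4 → ℂ) := by
    rw [pow_succ, pow_two, ← mulVec_mulVec, ← mulVec_mulVec, hu1, mulVec_smul, hu1, mulVec_smul,
      mulVec_smul, hu1, smul_smul, smul_smul]
    ring_nf
  rw [h, one_mulVec] at h3
  have : (1 : ℂ) = l ^ 3 := smul_left_injective ℂ hu0 (by simpa using h3)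
  exact this.symm

open Matrix in
theorem exists_joint (a b : Matrix (Fin 4) (Fin 4) ℂ) (ha : a ^ 3 = 1) (hb : b ^ 3 = 1)
    (hab : a * b = b * a) (ha1 : a ≠ 1) :
    ∃ (v : Fin 4 → ℂ) (l k : ℂ), v ≠ 0 ∧ l ^ 3 = 1 ∧ k ^ 3 = 1 ∧ l ≠ 1 ∧
      a *ᵥ v = l • v ∧ b *ᵥ v = k • v := by
  obtain ⟨x, hx⟩ : ∃ x, (a - 1) *ᵥ x ≠ 0 := by
    by_contra! hcon
    apply ha1
    rw [← sub_eq_zero]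
    apply Matrix.ext_of_mulVec_single
    intro i; rw [hcon, zero_mulVec]
  obtain ⟨u, ⟨y, hy⟩, hu0, l, hl, hul⟩ := exists_eig a ha (LinearMap.range (Matrix.toLin' (a - 1)))
    (by
      rintro _ ⟨y, rfl⟩
      refine ⟨a *ᵥ y, ?_⟩
      simp only [toLin'_apply, mulVec_mulVec]
      congr 1; noncomm_ring) ((a - 1) *ᵥ x) ⟨x, toLin'_apply _ _⟩ hx
  have hl1 : l ≠ 1 := by
    rintro rfl
    rw [one_smul] at hul
    have h1 : (a ^ 2 + a + 1) *ᵥ u = 0 := by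
      rw [← hy, toLin'_apply, mulVec_mulVec]
      have : (a ^ 2 + a + 1) * (a - 1) = 0 := by
        have : (a ^ 2 + a + 1) * (a - 1) = a ^ 3 - 1 := by noncomm_ring
        rw [this, ha, sub_self]
      rw [this, zero_mulVec]
    rw [add_mulVec, add_mulVec, one_mulVec, pow_two, ← mulVec_mulVec, hul, hul] at h1
    apply hu0
    have : (3 : ℂ) • u = 0 := by rw [← h1]; module
    simpa using this
  obtain ⟨v, hv, hv0, k, hk, hvk⟩ := exists_eig b hb
    (LinearMap.ker (Matrix.toLin' (a - l • (1 : Matrix (Fin 4) (Fin 4) ℂ))))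
    (by
      intro y hy
      rw [LinearMap.mem_ker, toLin'_apply] at hy ⊢
      rw [mulVec_mulVec]
      have : (a - l • (1 : Matrix (Fin 4) (Fin 4) ℂ)) * b = b * (a - l • 1) := by
        rw [sub_mul, mul_sub, hab]; simp
      rw [this, ← mulVec_mulVec, hy, mulVec_zero]) u
    (by simp [hul]) hu0
  refine ⟨v, l, k, hv0, hl, hk, hl1, ?_, hvk⟩
  rw [LinearMap.mem_ker, toLin'_apply, sub_mulVec, smul_mulVec, one_mulVec, sub_eq_zero] at hv
  exact hv

/-- normalise: find `c, e` in `⟨a, b⟩` acting diagonally on `v, tv, t²v, t³v`. -/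
theorem root_facts {ζ : ℂ} (h3 : ζ ^ 3 = 1) (h1 : ζ ≠ 1) : ζ ^ 2 + ζ + 1 = 0 := by
  apply mul_left_cancel₀ (sub_ne_zero.2 h1)
  linear_combination h3

open Matrix in
theorem core_basis (t c e : Matrix (Fin 4) (Fin 4) ℂ) (s ζ : ℂ) (v : Fin 4 → ℂ)
    (hζ : ζ ^ 3 = 1) (hζ1 : ζ ≠ 1) (hs : s ≠ 0) (ht : t ^ 4 = s • 1) (hv : v ≠ 0)
    (h1 : t * c = e * t) (h2 : t * e = c ^ 2 * t) (hc : c ^ 3 = 1)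
    (hcv : c *ᵥ v = ζ • v) (hev : e *ᵥ v = v) :
    ∃ B : Matrix (Fin 4) (Fin 4) ℂ, IsUnit B.det ∧ t * B = B * matT s ∧
      c * B = B * Matrix.diagonal ![ζ, 1, ζ ^ 2, 1] ∧
      e * B = B * Matrix.diagonal ![1, ζ, 1, ζ ^ 2] := by
  have hct : c * t = t * e ^ 2 := by
    rw [pow_two, ← mul_assoc, h2, mul_assoc, h2, ← mul_assoc, ← pow_add]
    rw [show 2 + 2 = 3 + 1 from rfl, pow_succ, hc, one_mul]
  let E : Fin 4 → (Fin 4 → ℂ) := ![v, t *ᵥ v, t *ᵥ (t *ᵥ v), t *ᵥ (t *ᵥ (t *ᵥ v))]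
  have sc : ∀ (w : Fin 4 → ℂ) (l : ℂ), e *ᵥ w = l • w → c *ᵥ (t *ᵥ w) = (l ^ 2) • (t *ᵥ w) := by
    intro w l h
    rw [mulVec_mulVec, hct, pow_two, ← mulVec_mulVec, ← mulVec_mulVec, h, mulVec_smul, h,
      mulVec_smul, mulVec_smul, smul_smul, pow_two]
  have se : ∀ (w : Fin 4 → ℂ) (l : ℂ), c *ᵥ w = l • w → e *ᵥ (t *ᵥ w) = l • (t *ᵥ w) := by
    intro w l h
    rw [mulVec_mulVec, ← h1, ← mulVec_mulVec, h, mulVec_smul]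
  have hz4 : (ζ ^ 2) ^ 2 = ζ := by linear_combination ζ * hζ
  have c0 : c *ᵥ E 0 = ζ • E 0 := hcv
  have e0 : e *ᵥ E 0 = (1 : ℂ) • E 0 := by rw [one_smul]; exact hev
  have c1 : c *ᵥ E 1 = (1 : ℂ) • E 1 := by
    have := sc _ _ e0
    rw [one_pow] at this; exact this
  have e1 : e *ᵥ E 1 = ζ • E 1 := se _ _ c0
  have c2 : c *ᵥ E 2 = (ζ ^ 2) • E 2 := sc _ _ e1
  have e2 : e *ᵥ E 2 = (1 : ℂ) • E 2 := se _ _ c1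
  have c3 : c *ᵥ E 3 = (1 : ℂ) • E 3 := by
    have := sc _ _ e2
    rw [one_pow] at this; exact this
  have e3 : e *ᵥ E 3 = (ζ ^ 2) • E 3 := se _ _ c2
  have cE : ∀ i, c *ᵥ E i = (![ζ, 1, ζ ^ 2, 1] : Fin 4 → ℂ) i • E i := by
    intro i; fin_cases i
    exacts [c0, c1, c2, c3]
  have eE : ∀ i, e *ᵥ E i = (![1, ζ, 1, ζ ^ 2] : Fin 4 → ℂ) i • E i := by
    intro i; fin_cases i
    exacts [e0, e1, e2, e3]
  have t4 : t *ᵥ E 3 = s • E 0 := by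
    change t *ᵥ (t *ᵥ (t *ᵥ (t *ᵥ v))) = s • v
    simp only [mulVec_mulVec]
    rw [show t * (t * (t * t)) = t ^ 4 by noncomm_ring, ht, smul_mulVec, one_mulVec]
  have tinj : ∀ w : Fin 4 → ℂ, w ≠ 0 → t *ᵥ w ≠ 0 := by
    intro w hw h0
    have : t ^ 4 *ᵥ w = 0 := by
      rw [pow_succ, ← mulVec_mulVec, h0, mulVec_zero]
    rw [ht, smul_mulVec, one_mulVec] at this
    exact hw ((smul_eq_zero.1 this).resolve_left hs)
  have E0 : ∀ i, E i ≠ 0 := by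
    intro i; fin_cases i
    exacts [hv, tinj _ hv, tinj _ (tinj _ hv), tinj _ (tinj _ (tinj _ hv))]
  have hr := root_facts hζ hζ1
  have hζ0 : ζ ≠ 0 := by rintro rfl; norm_num at hζ
  have lin : LinearIndependent ℂ E := by
    apply Module.End.eigenvectors_linearIndependent' (Matrix.toLin' (c + (2 : ℂ) • e))
      ![ζ + 2, 1 + 2 * ζ, ζ ^ 2 + 2, 1 + 2 * ζ ^ 2]
    · have n1 : ζ + 2 ≠ 1 + 2 * ζ := fun h => hζ1 (by linear_combination -h)
      have n2 : ζ + 2 ≠ ζ ^ 2 + 2 := fun h => hζ1 (by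
        apply mul_left_cancel₀ hζ0; linear_combination -h)
      have n3 : ζ + 2 ≠ 1 + 2 * ζ ^ 2 := fun h => hζ0 (by
        apply pow_eq_zero_iff (two_ne_zero) |>.1; linear_combination (hr - h) / 3)
      have n4 : 1 + 2 * ζ ≠ ζ ^ 2 + 2 := fun h => hζ0 (by linear_combination (h + hr) / 3)
      have n5 : 1 + 2 * ζ ≠ 1 + 2 * ζ ^ 2 := fun h => hζ1 (by
        apply mul_left_cancel₀ hζ0; linear_combination -h / 2)
      have n6 : ζ ^ 2 + 2 ≠ 1 + 2 * ζ ^ 2 := fun h => hζ1 (by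
        linear_combination h * ζ + hζ)
      intro i j hij
      fin_cases i <;> fin_cases j <;> first | rfl | (exfalso; simp at hij; first | exact n1 hij | exact n2 hij | exact n3 hij | exact n4 hij | exact n5 hij | exact n6 hij | exact n1 hij.symm | exact n2 hij.symm | exact n3 hij.symm | exact n4 hij.symm | exact n5 hij.symm | exact n6 hij.symm | grind)
    · intro i
      refine ⟨?_, E0 i⟩
      rw [Module.End.mem_eigenspace_iff, toLin'_apply, add_mulVec, smul_mulVec, cE, eE, smul_smul,
        ← add_smul]
      congr 1
      fin_cases i <;> simp
  let B : Matrix (Fin 4) (Fin 4) ℂ := (Matrix.of E)ᵀ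
  have hB : ∀ j, B.col j = E j := fun j => rfl
  have hcol : ∀ (M : Matrix (Fin 4) (Fin 4) ℂ) (i j : Fin 4), (M * B) i j = (M *ᵥ E j) i := by
    intro M i j; rfl
  refine ⟨B, ?_, ?_, ?_, ?_⟩
  · rw [← Matrix.isUnit_iff_isUnit_det, ← Matrix.linearIndependent_cols_iff_isUnit]
    exact lin
  · ext i j
    rw [hcol, Matrix.mul_apply, Fin.sum_univ_four]
    fin_cases j
    · simp [matT]; rfl
    · simp [matT]; rfl
    · simp [matT]; rfl
    · have := congrFun t4 i
      simp [matT] 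
      rw [this, mul_comm]; rfl
  · ext i j
    rw [hcol, Matrix.mul_diagonal, cE, mul_comm]; rfl
  · ext i j
    rw [hcol, Matrix.mul_diagonal, eE, mul_comm]; rfl
open Matrix in
theorem core2 (t c e X Y : Matrix (Fin 4) (Fin 4) ℂ) (s ζ : ℂ) (v : Fin 4 → ℂ)
    (hζ : ζ ^ 3 = 1) (hζ1 : ζ ≠ 1) (hs : s ≠ 0) (ht : t ^ 4 = s • 1) (hv : v ≠ 0)
    (h1 : t * c = e * t) (h2 : t * e = c ^ 2 * t) (hc : c ^ 3 = 1)
    (hcv : c *ᵥ v = ζ • v) (hev : e *ᵥ v = v) (hdet : t.det = 1)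
    (hX : X ^ 3 = 1) (hY : Y ^ 3 = 1) (hT : X * Y = t)
    (f : MvPolynomial (Fin 4) ℂ) (d : ℕ) (hf : f ≠ 0) (hh : f.IsHomogeneous d)
    (hd1 : 1 ≤ d) (hd4 : d ≤ 4) (hC : polyActHom c f = f) (hE : polyActHom e f = f)
    (μ ν : ℂ) (hμ : μ ^ 3 = 1) (hν : ν ^ 3 = 1) (hXF : polyActHom X f = μ • f)
    (hYF : polyActHom Y f = ν • f) : False := by
  obtain ⟨B, hB, tB, cB, eB⟩ := core_basis t c e s ζ v hζ hζ1 hs ht hv h1 h2 hc hcv hev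
  have hs' : s = -1 := by
    have := congrArg Matrix.det tB
    rw [det_mul, det_mul, hdet, matT_det, one_mul] at this
    have := mul_left_cancel₀ hB.ne_zero (show B.det * 1 = B.det * -s by rw [mul_one]; exact this)
    linear_combination this
  subst hs'
  have hBi : B * B⁻¹ = 1 := Matrix.mul_nonsing_inv _ hB
  have hiB : B⁻¹ * B = 1 := Matrix.nonsing_inv_mul _ hB
  by_cases hodd : Odd d
  · have hκ : (μ * ν) ^ 3 = 1 := by rw [mul_pow, hμ, hν, one_mul]
    have hTF : polyActHom t f = (μ * ν) • f := by
      rw [← hT, pa_mul, hXF, map_smul, hYF, smul_smul]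
    have h4 : polyActHom (t ^ 4) f = (μ * ν) ^ 4 • f := by
      rw [show t ^ 4 = t * t * t * t by noncomm_ring, pa_mul, pa_mul, pa_mul]
      simp only [hTF, map_smul, smul_smul]
      ring_nf
    rw [ht, neg_smul, one_smul, pa_neg hh, hodd.neg_one_pow] at h4
    have this : (-1 : ℂ) = (μ * ν) ^ 4 := smul_left_injective ℂ hf h4
    have h5 : μ * ν = -1 := by linear_combination - this - (μ * ν) * hκ
    rw [h5] at hκ; norm_num at hκ
  · have hd : d = 2 ∨ d = 4 := by
      interval_cases d
      · exact absurd (by decide) hodd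
      · simp
      · exact absurd (by decide) hodd
      · simp
    have conj : ∀ (M N : Matrix (Fin 4) (Fin 4) ℂ) (l : ℂ), M * B = B * N →
        polyActHom M f = l • f → polyActHom N (polyActHom B f) = l • polyActHom B f := by
      intro M N l h h'
      rw [← pa_mul, ← h, pa_mul, h', map_smul]
    have cube : ∀ M : Matrix (Fin 4) (Fin 4) ℂ, M ^ 3 = 1 → (B⁻¹ * M * B) ^ 3 = 1 := by
      intro M hM
      rw [pow_succ, pow_two]
      calc _ = B⁻¹ * M * (B * B⁻¹) * M * (B * B⁻¹) * M * B := by noncomm_ring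
        _ = B⁻¹ * (M ^ 3) * B := by rw [hBi]; noncomm_ring
        _ = 1 := by rw [hM, mul_one, hiB]
    have cm : ∀ M : Matrix (Fin 4) (Fin 4) ℂ, M * B = B * (B⁻¹ * M * B) := by
      intro M
      rw [← mul_assoc, ← mul_assoc, hBi, one_mul]
    refine core_diag hζ hζ1 (F := polyActHom B f) (d := d) ?_ (pa_hom B hh) hd ?_ ?_
      (B⁻¹ * X * B) (B⁻¹ * Y * B) (cube X hX) (cube Y hY) ?_ μ ν hμ hν (conj _ _ _ (cm X) hXF)
      (conj _ _ _ (cm Y) hYF)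
    · intro h0
      apply hf
      rw [← pa_one f, ← hBi, pa_mul, h0, map_zero]
    · have := conj _ _ 1 cB (by rw [one_smul, hC])
      rwa [one_smul] at this
    · have := conj _ _ 1 eB (by rw [one_smul, hE])
      rwa [one_smul] at this
    · calc _ = B⁻¹ * X * (B * B⁻¹) * Y * B := by noncomm_ring
        _ = B⁻¹ * (X * Y) * B := by rw [hBi]; noncomm_ring
        _ = matT (-1) := by rw [hT, mul_assoc, tB, ← mul_assoc, hiB, one_mul]

open Matrix in
theorem core_s3 (t a b X Y : Matrix (Fin 4) (Fin 4) ℂ) (s : ℂ)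
    (hs : s ≠ 0) (ht : t ^ 4 = s • 1)
    (h1 : t * a = b * t) (h2 : t * b = a ^ 2 * t) (ha : a ^ 3 = 1) (hb : b ^ 3 = 1)
    (hab : a * b = b * a) (ha1 : a ≠ 1) (hdet : t.det = 1)
    (hX : X ^ 3 = 1) (hY : Y ^ 3 = 1) (hT : X * Y = t)
    (f : MvPolynomial (Fin 4) ℂ) (d : ℕ) (hf : f ≠ 0) (hh : f.IsHomogeneous d)
    (hd1 : 1 ≤ d) (hd4 : d ≤ 4) (hA : polyActHom a f = f) (hB : polyActHom b f = f)
    (μ ν : ℂ) (hμ : μ ^ 3 = 1) (hν : ν ^ 3 = 1) (hXF : polyActHom X f = μ • f)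
    (hYF : polyActHom Y f = ν • f) : False := by
  obtain ⟨v, l, k, hv, hl, hk, hl1, hav, hbv⟩ := exists_joint a b ha hb hab ha1
  have hl2 : l ^ 2 ≠ 1 := by
    intro h; apply hl1; linear_combination hl - l * h
  have hl23 : (l ^ 2) ^ 3 = 1 := by rw [← pow_mul, mul_comm, pow_mul, hl, one_pow]
  have hcomm : Commute a b := hab
  have hr := root_facts hl hl1
  have hk3 : k = 1 ∨ k = l ∨ k = l ^ 2 := by
    have : (k - 1) * ((k - l) * (k - l ^ 2)) = 0 := by
      linear_combination hk - hl + (-k^2 + k * l) * hr 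
    rcases mul_eq_zero.1 this with h | h
    · left; linear_combination h
    · rcases mul_eq_zero.1 h with h | h
      · right; left; linear_combination h
      · right; right; linear_combination h
  rcases hk3 with rfl | rfl | rfl
  · exact core2 t a b X Y s l v hl hl1 hs ht hv h1 h2 ha hav (by simpa using hbv) hdet hX hY hT
      f d hf hh hd1 hd4 hA hB μ ν hμ hν hXF hYF
  · refine core2 t (a * b) (b * a ^ 2) X Y s (k ^ 2) v hl23 hl2 hs ht hv ?_ ?_ ?_ ?_ ?_ hdet hX hY hT
      f d hf hh hd1 hd4 ?_ ?_ μ ν hμ hν hXF hYF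
    · rw [← mul_assoc, h1, mul_assoc, h2, mul_assoc]
    · rw [← mul_assoc, h2, mul_assoc, pow_two a, ← mul_assoc t, h1, mul_assoc b, h1, hcomm.mul_pow]
      noncomm_ring
    · rw [hcomm.mul_pow, ha, hb, one_mul]
    · rw [← mulVec_mulVec, hbv, mulVec_smul, hav, smul_smul, pow_two]
    · rw [pow_two, ← mulVec_mulVec, ← mulVec_mulVec, hav, mulVec_smul, hav, mulVec_smul,
        mulVec_smul, hbv, smul_smul, smul_smul, ← pow_two, ← pow_succ, hl, one_smul]
    · rw [pa_mul, hA, hB]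
    · rw [pow_two, pa_mul, pa_mul, hB, hA, hA]
  · refine core2 t (a * b ^ 2) (b * a) X Y s (l ^ 2) v hl23 hl2 hs ht hv ?_ ?_ ?_ ?_ ?_ hdet hX hY hT
      f d hf hh hd1 hd4 ?_ ?_ μ ν hμ hν hXF hYF
    · rw [← mul_assoc, h1, mul_assoc, pow_two, ← mul_assoc t, h2, mul_assoc _ t, h2, ← mul_assoc,
        ← mul_assoc]
      rw [mul_assoc b, ← pow_add, show 2 + 2 = 3 + 1 from rfl, pow_succ, ha, one_mul]
    · rw [← mul_assoc, h2, mul_assoc, h1, (hcomm.pow_right 2).mul_pow, ← pow_mul, 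
        show 2 * 2 = 3 + 1 from rfl, pow_succ b, hb, one_mul, mul_assoc]
    · rw [(hcomm.pow_right 2).mul_pow, ha, ← pow_mul, mul_comm 2 3, pow_mul, hb, one_mul, one_pow]
    · rw [pow_two, ← mulVec_mulVec, ← mulVec_mulVec, hbv, mulVec_smul, hbv, mulVec_smul, 
        mulVec_smul, hav, smul_smul, smul_smul]
      congr 1
      linear_combination l ^ 2 * hl
    · rw [← mulVec_mulVec, hav, mulVec_smul, hbv, smul_smul, ← pow_succ', hl, one_smul]
    · rw [pow_two, pa_mul, pa_mul, hA, hB, hB]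
    · rw [pa_mul, hB, hA]

theorem group_core {Q : Type*} [Group Q] (G : Subgroup (Matrix.SpecialLinearGroup (Fin 4) ℂ))
    (hneg : negId ∈ G) (φ : G →* Q) (hsurj : Function.Surjective φ)
    (hker : φ.ker = Subgroup.zpowers (⟨negId, hneg⟩ : G))
    (x y p : Q) (hx : x ^ 3 = 1) (hy : y ^ 3 = 1) (hp : p ^ 3 = 1) (hp1 : p ≠ 1)
    (ht4 : (x * y) ^ 4 = 1) (hcomm : p * ((x * y) * p * (x * y)⁻¹) = ((x * y) * p * (x * y)⁻¹) * p)
    (hinv : (x * y) * ((x * y) * p * (x * y)⁻¹) * (x * y)⁻¹ = p⁻¹)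
    (f : MvPolynomial (Fin 4) ℂ) (d : ℕ) (χ : G →* ℂˣ) (hf : f ≠ 0) (hh : f.IsHomogeneous d)
    (hd1 : 1 ≤ d) (hd4 : d ≤ 4)
    (hact : ∀ g : G,
          polyAct ((g⁻¹ : Matrix.SpecialLinearGroup (Fin 4) ℂ) : Matrix (Fin 4) (Fin 4) ℂ) f
            = (χ g : ℂ) • f) : False := by
  set z : G := ⟨negId, hneg⟩ with hz
  let M : G →* Matrix (Fin 4) (Fin 4) ℂ :=
      { toFun := fun g => ((g : Matrix.SpecialLinearGroup (Fin 4) ℂ) : Matrix (Fin 4) (Fin 4) ℂ)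
        map_one' := by simp
        map_mul' := by intro a b; simp }
  have hM : ∀ g : G, M g = ((g : Matrix.SpecialLinearGroup (Fin 4) ℂ) : Matrix (Fin 4) (Fin 4) ℂ) :=
    fun _ => rfl
  have hMinj : Function.Injective M := by
    intro a b h
    exact Subtype.ext (Subtype.ext h)
  have Mz : M z = -1 := rfl
  have hz2 : z * z = 1 := by
    apply hMinj; rw [map_mul, Mz, map_one]; simp
  have hz1 : z ≠ 1 := by
    intro h
    have := congrArg M h
    rw [Mz, map_one] at this
    have := congrFun (congrFun this 0) 0
    norm_num at this
  have hzc : ∀ g, z * g = g * z := by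
    intro g; apply hMinj; rw [map_mul, map_mul, Mz]; simp
  have hz3 : z ^ 3 = z := by rw [pow_succ, pow_two, hz2, one_mul]
  have kerz : ∀ g, φ g = 1 → g = 1 ∨ g = z := by
    intro g hg
    have : g ∈ φ.ker := hg
    rw [hker] at this
    obtain ⟨n, rfl⟩ := this
    have hz2' : z ^ (2 : ℤ) = 1 := by
      rw [zpow_two, hz2]
    rcases Int.even_or_odd' n with ⟨k, rfl | rfl⟩
    · left; simp only [zpow_mul, hz2', one_zpow]
    · right; simp only [zpow_add, zpow_mul, hz2', one_zpow, zpow_one, one_mul]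
  have kerz2 : ∀ g h, φ g = φ h → g = h ∨ g = z * h := by
    intro g h hgh
    rcases kerz (g * h⁻¹) (by rw [map_mul, map_inv, hgh, mul_inv_cancel]) with e | e
    · left; exact mul_inv_eq_one.1 e
    · right; exact mul_inv_eq_iff_eq_mul.1 e
  have hzmul : ∀ g : G, (z * g) ^ 3 = z * g ^ 3 := by
    intro g
    rw [(show Commute z g from hzc g).mul_pow, hz3]
  -- two elements of order 3 with the same image agree
  have uniq : ∀ g h, g ^ 3 = 1 → h ^ 3 = 1 → φ g = φ h → g = h := by
    intro g h hg hh' e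
    rcases kerz2 g h e with e | e
    · exact e
    · exfalso
      apply hz1
      rw [e, hzmul, hh', mul_one] at hg
      exact hg
  have lift3 : ∀ q : Q, q ^ 3 = 1 → ∃ g : G, g ^ 3 = 1 ∧ φ g = q := by
    intro q hq
    obtain ⟨g, rfl⟩ := hsurj q
    rcases kerz (g ^ 3) (by rw [map_pow, hq]) with e | e
    · exact ⟨g, e, rfl⟩
    · refine ⟨z * g, by rw [hzmul, e, hz2], ?_⟩
      have : z ∈ φ.ker := by rw [hker]; exact Subgroup.mem_zpowers z
      rw [map_mul, MonoidHom.mem_ker.1 this, one_mul]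
  obtain ⟨X, hX, rfl⟩ := lift3 x hx
  obtain ⟨Y, hY, rfl⟩ := lift3 y hy
  obtain ⟨a, ha, rfl⟩ := lift3 p hp
  have conj3 : ∀ g h : G, h ^ 3 = 1 → (g * h * g⁻¹) ^ 3 = 1 := by
    intro g h hh'
    rw [conj_pow, hh', mul_one, mul_inv_cancel]
  set t := X * Y with ht
  set b := t * a * t⁻¹ with hbdef
  have hb : b ^ 3 = 1 := conj3 t a ha
  have hab : a * b = b * a := by
    have := uniq (a * b * a⁻¹) b (conj3 a b hb) hb (by
      simp only [map_mul, map_inv, hbdef, ht]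
      exact mul_inv_eq_iff_eq_mul.2 hcomm)
    exact mul_inv_eq_iff_eq_mul.1 this
  have htb : t * b * t⁻¹ = a⁻¹ := by
    refine uniq _ _ (conj3 t b hb) (by rw [inv_pow, ha, inv_one]) ?_
    simp only [map_mul, map_inv, hbdef, ht]
    simpa only [map_mul, map_inv] using hinv
  have hainv : a⁻¹ = a ^ 2 := by
    rw [inv_eq_iff_mul_eq_one, ← pow_succ', ha]
  have ht4' : t ^ 4 = 1 ∨ t ^ 4 = z := kerz _ (by rw [map_pow, ht, map_mul, ht4])
  have hact' : ∀ g : G, polyActHom (M g) f = ((χ g⁻¹ : ℂˣ) : ℂ) • f := by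
    intro g
    rw [← hact, polyAct_eq, hM]
    simp
  have cub : ∀ g : G, g ^ 3 = 1 → ((χ g⁻¹ : ℂˣ) : ℂ) ^ 3 = 1 := by
    intro g hg
    rw [← Units.val_pow_eq_pow_val, ← map_pow, inv_pow, hg]; simp
  have χa : χ a = 1 := by
    have h1 : χ b = χ a := by rw [hbdef, map_mul, map_mul, map_inv]; simp
    have h2 : χ (a⁻¹) = χ b := by rw [← htb, map_mul, map_mul, map_inv]; simp
    rw [hainv, h1, map_pow] at h2
    have h3 : χ a * χ a = χ a * 1 := by rw [← pow_two, h2, mul_one]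
    exact mul_left_cancel h3
  have χb : χ b = 1 := by rw [hbdef, map_mul, map_mul, map_inv, χa]; simp
  obtain ⟨s, hs, hts⟩ : ∃ s : ℂ, s ≠ 0 ∧ (M t) ^ 4 = s • 1 := by
    rcases ht4' with h | h
    · exact ⟨1, one_ne_zero, by rw [← map_pow, h, map_one, one_smul]⟩
    · exact ⟨-1, by norm_num, by rw [← map_pow, h, Mz, neg_smul, one_smul]⟩
  refine core_s3 (M t) (M a) (M b) (M X) (M Y) s hs hts ?_ ?_ ?_ ?_ ?_ ?_ ?_ ?_ ?_ ?_ f d hf hh hd1 hd4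
    ?_ ?_ _ _ (cub X hX) (cub Y hY) (hact' X) (hact' Y)
  · rw [← map_mul, ← map_mul, hbdef]; simp
  · rw [← map_mul, ← map_pow, ← map_mul, ← hainv, ← htb]; simp
  · rw [← map_pow, ha, map_one]
  · rw [← map_pow, hb, map_one]
  · rw [← map_mul, hab, map_mul]
  · intro h
    apply hp1
    rw [hMinj (h.trans (map_one M).symm), map_one]
  · rw [hM]; exact Matrix.SpecialLinearGroup.det_coe _
  · rw [← map_pow, hX, map_one]
  · rw [← map_pow, hY, map_one]
  · rw [← map_mul]
  · rw [hact', map_inv, χa]; simp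
  · rw [hact', map_inv, χb]; simp

def x6 : Equiv.Perm (Fin 6) :=
  ⟨![0, 1, 3, 4, 2, 5], ![0, 1, 4, 2, 3, 5], by decide, by decide⟩
def y6 : Equiv.Perm (Fin 6) :=
  ⟨![2, 3, 5, 4, 1, 0], ![5, 4, 0, 1, 3, 2], by decide, by decide⟩
def a6 : Equiv.Perm (Fin 6) :=
  ⟨![1, 2, 0, 3, 4, 5], ![2, 0, 1, 3, 4, 5], by decide, by decide⟩
def x7 : Equiv.Perm (Fin 7) :=
  ⟨![0, 1, 3, 4, 2, 5, 6], ![0, 1, 4, 2, 3, 5, 6], by decide, by decide⟩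
def y7 : Equiv.Perm (Fin 7) :=
  ⟨![2, 3, 5, 4, 1, 0, 6], ![5, 4, 0, 1, 3, 2, 6], by decide, by decide⟩
def a7 : Equiv.Perm (Fin 7) :=
  ⟨![1, 2, 0, 3, 4, 5, 6], ![2, 0, 1, 3, 4, 5, 6], by decide, by decide⟩

theorem mem_alt {p : Equiv.Perm (Fin 7)} (h : p ^ 3 = 1) : p ∈ alternatingGroup (Fin 7) := by
  rw [Equiv.Perm.mem_alternatingGroup]
  have := congrArg Equiv.Perm.sign h
  rw [map_pow, map_one] at this
  rcases Int.units_eq_one_or (Equiv.Perm.sign p) with e | e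
  · exact e
  · rw [e] at this; exact absurd this (by decide)

theorem hx7 : x7 ^ 3 = 1 := by ext i; revert i; decide
theorem hy7 : y7 ^ 3 = 1 := by ext i; revert i; decide
theorem ha7 : a7 ^ 3 = 1 := by ext i; revert i; decide

/-- A finite subgroup `G ≤ SL(4,ℂ)` containing `-I`, with `G/{±I} ≅ S₆` or `G/{±I} ≅ A₇`,
whose tautological action on `ℂ⁴` is irreducible, has no semi-invariants of degree at
most `4`. -/
theorem stmt_3 (G : Subgroup (Matrix.SpecialLinearGroup (Fin 4) ℂ)) [Finite G]
    (hneg : negId ∈ G)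
    (hquot :
      (∃ φ : G →* Equiv.Perm (Fin 6),
        Function.Surjective φ ∧ φ.ker = Subgroup.zpowers (⟨negId, hneg⟩ : G)) ∨
      (∃ φ : G →* alternatingGroup (Fin 7),
        Function.Surjective φ ∧ φ.ker = Subgroup.zpowers (⟨negId, hneg⟩ : G)))
    (hirr : ∀ W : Submodule ℂ (Fin 4 → ℂ),
      (∀ g : G, ∀ v ∈ W,
        ((g : Matrix.SpecialLinearGroup (Fin 4) ℂ) : Matrix (Fin 4) (Fin 4) ℂ).mulVec v ∈ W) →
      W = ⊥ ∨ W = ⊤) :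
    ¬ ∃ (f : MvPolynomial (Fin 4) ℂ) (d : ℕ) (χ : G →* ℂˣ),
        f ≠ 0 ∧ f.IsHomogeneous d ∧ 1 ≤ d ∧ d ≤ 4 ∧
        ∀ g : G,
          polyAct ((g⁻¹ : Matrix.SpecialLinearGroup (Fin 4) ℂ) : Matrix (Fin 4) (Fin 4) ℂ) f
            = (χ g : ℂ) • f := by
  rintro ⟨f, d, χ, hf, hh, hd1, hd4, hact⟩
  rcases hquot with ⟨φ, hs, hk⟩ | ⟨φ, hs, hk⟩
  · exact group_core G hneg φ hs hk x6 y6 a6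
      (by ext i; revert i; decide) (by ext i; revert i; decide) (by ext i; revert i; decide)
      (by decide) (by ext i; revert i; decide) (by ext i; revert i; decide)
      (by ext i; revert i; decide) f d χ hf hh hd1 hd4 hact
  · exact group_core G hneg φ hs hk ⟨x7, mem_alt hx7⟩ ⟨y7, mem_alt hy7⟩ ⟨a7, mem_alt ha7⟩
      (Subtype.ext hx7) (Subtype.ext hy7) (Subtype.ext ha7)
      (fun h => absurd (congrArg Subtype.val h) (show a7 ≠ 1 by decide))
      (Subtype.ext (show (x7 * y7) ^ 4 = 1 by ext i; revert i; decide))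
      (Subtype.ext (show a7 * ((x7 * y7) * a7 * (x7 * y7)⁻¹) = ((x7 * y7) * a7 * (x7 * y7)⁻¹) * a7 by
        ext i; revert i; decide))
      (Subtype.ext (show (x7 * y7) * ((x7 * y7) * a7 * (x7 * y7)⁻¹) * (x7 * y7)⁻¹ = a7⁻¹ by
        ext i; revert i; decide)) f d χ hf hh hd1 hd4 hact
end
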